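/- arXiv:1103.4367 — 2 statements merged into one kernel-verified Lean document; each statement's English description precedes it below -/
import Mathlib

section
/- Let k be a field of characteristic 0, L₁ and L₂ Lie algebras over k, and L = L₁ × L₂ their direct product. Let M₁ be a finite-dimensional L₁-module and M₂ a finite-dimensional L₂-module, and regard M₁ ⊗ M₂ as an L-module via (x₁,x₂)•(m₁⊗m₂) = (x₁•m₁)⊗m₂ + m₁⊗(x₂•m₂). Then there is a k-linear isomorphism H¹(L, M₁⊗M₂) ≅ (M₁^{L₁} ⊗ H¹(L₂,M₂)) ⊕ (H¹(L₁,M₁) ⊗ M₂^{L₂}). -/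
/-! Künneth formula for first Lie algebra cohomology of a direct product. -/

open scoped TensorProduct

section ProdLie

variable {k L₁ L₂ : Type*} [CommRing k] [LieRing L₁] [LieAlgebra k L₁]
  [LieRing L₂] [LieAlgebra k L₂]

/-- The direct product of two Lie rings, with componentwise bracket. -/
instance Prod.instLieRing : LieRing (L₁ × L₂) where
  bracket x y := (⁅x.1, y.1⁆, ⁅x.2, y.2⁆)
  add_lie x y z := by simp [Prod.ext_iff]
  lie_add x y z := by simp [Prod.ext_iff]
  lie_self x := by simp [Prod.ext_iff]
  leibniz_lie x y z := by simp [Prod.ext_iff]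

/-- The direct product of two Lie algebras. -/
instance Prod.instLieAlgebra : LieAlgebra k (L₁ × L₂) where
  lie_smul c x y := Prod.ext_iff.mpr ⟨lie_smul c x.1 y.1, lie_smul c x.2 y.2⟩

/-- The first projection, as a morphism of Lie algebras. -/
def LieHom.prodFst : (L₁ × L₂) →ₗ⁅k⁆ L₁ := { LinearMap.fst k L₁ L₂ with map_lie' := rfl }

/-- The second projection, as a morphism of Lie algebras. -/
def LieHom.prodSnd : (L₁ × L₂) →ₗ⁅k⁆ L₂ := { LinearMap.snd k L₁ L₂ with map_lie' := rfl }

end ProdLie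

section H1

variable (k L M : Type*) [CommRing k] [LieRing L] [LieAlgebra k L]
  [AddCommGroup M] [Module k M] [LieRingModule L M] [LieModule k L M]

/-- The inner derivations from `L` to `M`, as a submodule of all Lie derivations. -/
def innerLieDerivations : Submodule k (LieDerivation k L M) where
  carrier := {d | ∃ v : M, ∀ x : L, d x = ⁅x, v⁆}
  add_mem' := by
    rintro d e ⟨v, hv⟩ ⟨w, hw⟩
    exact ⟨v + w, fun x => by simp [hv x, hw x]⟩
  zero_mem' := ⟨0, fun x => by simp⟩
  smul_mem' := by
    rintro c d ⟨v, hv⟩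
    exact ⟨c • v, fun x => by simp [hv x]⟩

/-- The first Lie algebra cohomology `H¹(L,M) = Der(L,M)/IDer(L,M)`. -/
def lieH1 := LieDerivation k L M ⧸ innerLieDerivations k L M

noncomputable instance : AddCommGroup (lieH1 k L M) := Submodule.Quotient.addCommGroup _
noncomputable instance : Module k (lieH1 k L M) := Submodule.Quotient.module _

end H1

variable (k L₁ L₂ M₁ M₂ : Type*) [Field k] [CharZero k]
  [LieRing L₁] [LieAlgebra k L₁] [LieRing L₂] [LieAlgebra k L₂]
  [AddCommGroup M₁] [Module k M₁] [LieRingModule L₁ M₁] [LieModule k L₁ M₁]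
  [AddCommGroup M₂] [Module k M₂] [LieRingModule L₂ M₂] [LieModule k L₂ M₂]

/-- `M₁` as a module over `L₁ × L₂`, the second factor acting trivially. -/
instance fstModule : LieRingModule (L₁ × L₂) M₁ where
  bracket x m := ⁅x.1, m⁆
  add_lie x y m := add_lie x.1 y.1 m
  lie_add x m n := lie_add x.1 m n
  leibniz_lie x y m := leibniz_lie x.1 y.1 m

instance fstLieModule : LieModule k (L₁ × L₂) M₁ where
  smul_lie c x m := smul_lie c x.1 m
  lie_smul c x m := lie_smul c x.1 m

/-- `M₂` as a module over `L₁ × L₂`, the first factor acting trivially. -/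
instance sndModule : LieRingModule (L₁ × L₂) M₂ where
  bracket x m := ⁅x.2, m⁆
  add_lie x y m := add_lie x.2 y.2 m
  lie_add x m n := lie_add x.2 m n
  leibniz_lie x y m := leibniz_lie x.2 y.2 m

instance sndLieModule : LieModule k (L₁ × L₂) M₂ where
  smul_lie c x m := smul_lie c x.2 m
  lie_smul c x m := lie_smul c x.2 m

section Splitting

open TensorProduct

variable {F : Type*} [Field F]
  {V A K C : Type*} [AddCommGroup V] [Module F V] [AddCommGroup A] [Module F A]
  [AddCommGroup K] [Module F K] [AddCommGroup C] [Module F C]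
  {W B N D : Type*} [AddCommGroup W] [Module F W] [AddCommGroup B] [Module F B]
  [AddCommGroup N] [Module F N] [AddCommGroup D] [Module F D]

/-- A two-term complex of vector spaces `f : V → A` is homotopy equivalent to its cohomology
`0 : K → C`. -/
theorem exists_splitting_of_exact {f : V →ₗ[F] A} {i : K →ₗ[F] V} {π : A →ₗ[F] C}
    (hi : Function.Injective i) (hif : Function.Exact i f) (hfπ : Function.Exact f π)
    (hπ : Function.Surjective π) :
    ∃ (p : V →ₗ[F] K) (h : A →ₗ[F] V) (s : C →ₗ[F] A),
      p ∘ₗ i = .id ∧ π ∘ₗ s = .id ∧ h ∘ₗ f + i ∘ₗ p = .id ∧ f ∘ₗ h + s ∘ₗ π = .id := by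
  obtain ⟨p, hp⟩ := i.exists_leftInverse_of_injective (LinearMap.ker_eq_bot.2 hi)
  obtain ⟨s, hs⟩ := π.exists_rightInverse_of_surjective (LinearMap.range_eq_top.2 hπ)
  obtain ⟨r, hr⟩ := f.rangeRestrict.exists_rightInverse_of_surjective f.range_rangeRestrict
  have hp' (x : K) : p (i x) = x := LinearMap.congr_fun hp x
  have hs' (c : C) : π (s c) = c := LinearMap.congr_fun hs c
  have hr' (y : LinearMap.range f) : f (r y) = y :=
    congrArg Subtype.val (LinearMap.congr_fun hr y)
  have hfi (x : K) : f (i x) = 0 := hif.apply_apply_eq_zero x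
  have hπf (v : V) : π (f v) = 0 := hfπ.apply_apply_eq_zero v
  have hmem (a : A) : (LinearMap.id - s ∘ₗ π : A →ₗ[F] A) a ∈ LinearMap.range f :=
    (hfπ _).1 (by simp [hs'])
  refine ⟨p, (LinearMap.id - i ∘ₗ p) ∘ₗ r ∘ₗ LinearMap.codRestrict _ _ hmem, s, hp, hs, ?_, ?_⟩
  · ext v
    set w := r (LinearMap.codRestrict _ _ hmem (f v)) with hw
    have hfw : f (w - v) = 0 := by rw [map_sub, hw, hr']; simp [hπf]
    obtain ⟨x, hx⟩ := (hif _).1 hfw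
    have hwx : w = v + i x := by rw [hx]; abel
    change w - i (p w) + i (p v) = v
    rw [hwx, map_add, map_add, hp']
    abel
  · ext a
    simp [hfi, hr']

/-- The degree one cocycles of the tensor product of the two-term complexes `f` and `g`. -/
def tensorCocycles (f : V →ₗ[F] A) (g : W →ₗ[F] B) : Submodule F ((A ⊗[F] W) × (V ⊗[F] B)) :=
  LinearMap.eqLocus (map .id g ∘ₗ .fst F _ _) (map f .id ∘ₗ .snd F _ _)

/-- The degree zero differential of the tensor product of the two-term complexes `f` and `g`. -/
def tensorDifferential (f : V →ₗ[F] A) (g : W →ₗ[F] B) :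
    V ⊗[F] W →ₗ[F] (A ⊗[F] W) × (V ⊗[F] B) :=
  (map f .id).prod (map .id g)

theorem mem_tensorCocycles {f : V →ₗ[F] A} {g : W →ₗ[F] B} {a : A ⊗[F] W} {b : V ⊗[F] B} :
    (a, b) ∈ tensorCocycles f g ↔ map .id g a = map f .id b := Iff.rfl

theorem tensorDifferential_mem_tensorCocycles (f : V →ₗ[F] A) (g : W →ₗ[F] B) (u : V ⊗[F] W) :
    tensorDifferential f g u ∈ tensorCocycles f g := by
  change map _ _ (map _ _ u) = map _ _ (map _ _ u)
  simp [map_map]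

/-- The Künneth formula in degree one for two-term complexes of vector spaces. -/
theorem exists_tensorCocycles_kunneth {f : V →ₗ[F] A} {i : K →ₗ[F] V} {π : A →ₗ[F] C}
    (hi : Function.Injective i) (hif : Function.Exact i f) (hfπ : Function.Exact f π)
    (hπ : Function.Surjective π) {g : W →ₗ[F] B} {j : N →ₗ[F] W} {ρ : B →ₗ[F] D}
    (hj : Function.Injective j) (hjg : Function.Exact j g) (hgρ : Function.Exact g ρ)
    (hρ : Function.Surjective ρ) :
    ∃ Φ : tensorCocycles f g →ₗ[F] (K ⊗[F] D) × (C ⊗[F] N), Function.Surjective Φ ∧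
      LinearMap.ker Φ =
        (LinearMap.range (tensorDifferential f g)).comap (tensorCocycles f g).subtype := by
  obtain ⟨p, h, s, hpi, hπs, hhf, hfh⟩ := exists_splitting_of_exact hi hif hfπ hπ
  obtain ⟨q, l, t, hqj, hρt, hlg, hgl⟩ := exists_splitting_of_exact hj hjg hgρ hρ
  have hfi : f ∘ₗ i = 0 := hif.linearMap_comp_eq_zero
  have hπf : π ∘ₗ f = 0 := hfπ.linearMap_comp_eq_zero
  have hgj : g ∘ₗ j = 0 := hjg.linearMap_comp_eq_zero
  have hρg : ρ ∘ₗ g = 0 := hgρ.linearMap_comp_eq_zero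
  refine ⟨((map p ρ ∘ₗ .snd F _ _).prod (map π q ∘ₗ .fst F _ _)) ∘ₗ Submodule.subtype _, ?_, ?_⟩
  · rintro ⟨u, v⟩
    refine ⟨⟨(map s j v, map i t u), ?_⟩, ?_⟩
    · rw [mem_tensorCocycles, map_map, map_map]
      simp [hfi, hgj]
    · simp [map_map, hpi, hπs, hqj, hρt]
  · ext ⟨⟨a, b⟩, hab⟩
    rw [mem_tensorCocycles] at hab
    constructor
    · intro h0
      have hb : map p ρ b = 0 := congrArg Prod.fst h0
      have ha : map π q a = 0 := congrArg Prod.snd h0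
      refine ⟨map h .id a + map (i ∘ₗ p) l b, Prod.ext ?_ ?_⟩
      · have hπa : map π .id a = 0 := by
          have h1 : map π l (map .id g a) = 0 := by
            rw [hab, map_map, hπf, map_zero_left, LinearMap.zero_apply]
          have h2 : map .id j (map π q a) = 0 := by rw [ha, map_zero]
          rw [map_map, LinearMap.comp_id] at h1
          rw [map_map, LinearMap.id_comp] at h2
          rw [← hlg, map_add_right, LinearMap.add_apply, h1, h2, add_zero]
        have h3 : map s .id (map π .id a) = 0 := by rw [hπa, map_zero]
        have h4 : map (f ∘ₗ h + s ∘ₗ π) (.id ∘ₗ .id) a = a := by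
          rw [hfh, LinearMap.id_comp, map_id, LinearMap.id_apply]
        rw [map_map] at h3
        rw [map_add_left, LinearMap.add_apply, h3, add_zero] at h4
        change map f .id (_ + _) = a
        rw [map_add, map_map, map_map, ← LinearMap.comp_assoc, hfi, LinearMap.zero_comp,
          map_zero_left, LinearMap.zero_apply, add_zero, h4]
      · have h1 : map i t (map p ρ b) = 0 := by rw [hb, map_zero]
        have h2 : map h .id (map .id g a) = map h .id (map f .id b) := by rw [hab]
        have h3 : map (h ∘ₗ f + i ∘ₗ p) .id b = b := by rw [hhf, map_id, LinearMap.id_apply]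
        have h4 : map (i ∘ₗ p) (g ∘ₗ l + t ∘ₗ ρ) b = map (i ∘ₗ p) .id b := by rw [hgl]
        rw [map_map] at h1
        simp only [map_map, LinearMap.comp_id, LinearMap.id_comp] at h2
        rw [map_add_left, LinearMap.add_apply] at h3
        rw [map_add_right, LinearMap.add_apply, h1, add_zero] at h4
        change map .id g (_ + _) = b
        simp only [map_add, map_map, LinearMap.comp_id, LinearMap.id_comp]
        rw [h2, h4, h3]
    · rintro ⟨z, hz⟩
      obtain rfl : map f .id z = a := congrArg Prod.fst hz
      obtain rfl : map .id g z = b := congrArg Prod.snd hz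
      simp [map_map, hπf, hρg]

/-- A jointly injective family of linear maps stays jointly injective after tensoring on the
right with a vector space. -/
theorem eq_zero_of_forall_rTensor {ι : Type*} (e : ι → A →ₗ[F] V)
    (he : ∀ a, (∀ x, e x a = 0) → a = 0) (u : A ⊗[F] W)
    (hu : ∀ x, map (e x) (.id : W →ₗ[F] W) u = 0) : u = 0 := by
  classical
  let b := Module.Basis.ofVectorSpace F W
  refine (equivFinsuppOfBasisRight (M := A) b).injective (Finsupp.ext fun n => ?_)
  rw [map_zero, Finsupp.zero_apply]
  refine he _ fun x => ?_
  have key : e x (equivFinsuppOfBasisRight b u n) =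
      equivFinsuppOfBasisRight b (map (e x) .id u) n := by
    clear hu
    induction u with
    | zero => simp
    | tmul a w => simp
    | add u v hu hv => simp [hu, hv]
  rw [key, hu, map_zero, Finsupp.zero_apply]

/-- A jointly injective family of linear maps stays jointly injective after tensoring on the
left with a vector space. -/
theorem eq_zero_of_forall_lTensor {ι : Type*} (e : ι → A →ₗ[F] V)
    (he : ∀ a, (∀ x, e x a = 0) → a = 0) (u : W ⊗[F] A)
    (hu : ∀ x, map (.id : W →ₗ[F] W) (e x) u = 0) : u = 0 := by
  refine (TensorProduct.comm F W A).map_eq_zero_iff.1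
    (eq_zero_of_forall_rTensor e he _ fun x => ?_)
  rw [map_comm, hu, map_zero]

end Splitting

section Derivations

open TensorProduct

variable {F G V W : Type*} [Field F] [LieRing G] [LieAlgebra F G]
  [AddCommGroup V] [Module F V] [LieRingModule G V] [LieModule F G V]
  [AddCommGroup W] [Module F W]

/-- Evaluation of Lie derivations at a fixed element, as a linear map. -/
def LieDerivation.evalAt (x : G) : LieDerivation F G V →ₗ[F] V where
  toFun d := d x
  map_add' _ _ := rfl
  map_smul' _ _ := rfl

@[simp]
theorem LieDerivation.evalAt_apply (x : G) (d : LieDerivation F G V) : evalAt x d = d x := rfl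

theorem LieDerivation.evalAt_zero : (evalAt 0 : LieDerivation F G V →ₗ[F] V) = 0 := by
  ext d
  simp

theorem LieDerivation.evalAt_add (x y : G) :
    (evalAt (x + y) : LieDerivation F G V →ₗ[F] V) = evalAt x + evalAt y := by
  ext d
  simp

theorem LieDerivation.evalAt_smul (c : F) (x : G) :
    (evalAt (c • x) : LieDerivation F G V →ₗ[F] V) = c • evalAt x := by
  ext d
  simp

theorem LieDerivation.evalAt_lie (x y : G) :
    (evalAt ⁅x, y⁆ : LieDerivation F G V →ₗ[F] V) =
      LieModule.toEnd F G V x ∘ₗ evalAt y - LieModule.toEnd F G V y ∘ₗ evalAt x := by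
  ext d
  simp

theorem LieDerivation.evalAt_comp_inner (x : G) :
    evalAt x ∘ₗ LieDerivation.inner F G V = LieModule.toEnd F G V x := by
  ext v
  simp

/-- A derivation with values in `V ⊗ W`, where `W` is a finite-dimensional trivial module, comes
from an element of `Der(G, V) ⊗ W`. -/
theorem exists_tensor_evalAt_eq [FiniteDimensional F W] (c : G →ₗ[F] V ⊗[F] W)
    (hc : ∀ x y, c ⁅x, y⁆ =
      map (LieModule.toEnd F G V x) .id (c y) - map (LieModule.toEnd F G V y) .id (c x)) :
    ∃ a : LieDerivation F G V ⊗[F] W, ∀ x, map (LieDerivation.evalAt x) .id a = c x := by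
  classical
  let b := Module.finBasis F W
  let coeff (n) : V ⊗[F] W →ₗ[F] V :=
    Finsupp.lapply n ∘ₗ (equivFinsuppOfBasisRight (M := V) b).toLinearMap
  have hcoeff (n) (x : G) (u : V ⊗[F] W) :
      coeff n (map (LieModule.toEnd F G V x) .id u) = ⁅x, coeff n u⁆ := by
    induction u with
    | zero => simp
    | tmul v w => simp [coeff]
    | add u v hu hv => rw [map_add, map_add, hu, hv, map_add, lie_add]
  have hsum (u : V ⊗[F] W) : ∑ n, coeff n u ⊗ₜ[F] b n = u := by
    have := (equivFinsuppOfBasisRight (M := V) b).symm_apply_apply u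
    rwa [equivFinsuppOfBasisRight_symm_apply, Finsupp.sum_fintype _ _ (by simp)] at this
  let d (n) : LieDerivation F G V :=
    { toLinearMap := coeff n ∘ₗ c
      leibniz' := fun x y => by simp only [LinearMap.comp_apply, hc, map_sub, hcoeff] }
  refine ⟨∑ n, d n ⊗ₜ b n, fun x => ?_⟩
  rw [map_sum, ← hsum (c x)]
  rfl

theorem exact_subtype_maxTrivSubmodule_inner :
    Function.Exact (LieModule.maxTrivSubmodule F G V).toSubmodule.subtype
      (LieDerivation.inner F G V) := by
  intro v
  rw [LieDerivation.ext_iff]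
  simp

/-- The class in `H¹` of a Lie derivation. -/
noncomputable def lieH1.mk : LieDerivation F G V →ₗ[F] lieH1 F G V :=
  (innerLieDerivations F G V).mkQ

theorem lieH1.mk_surjective : Function.Surjective (lieH1.mk : LieDerivation F G V →ₗ[F] _) :=
  Submodule.mkQ_surjective _

theorem innerLieDerivations_eq_range :
    innerLieDerivations F G V = LinearMap.range (LieDerivation.inner F G V) := by
  ext d
  simp only [LinearMap.mem_range, LieDerivation.ext_iff, eq_comm]
  rfl

theorem exact_inner_lieH1_mk :
    Function.Exact (LieDerivation.inner F G V) (lieH1.mk : LieDerivation F G V →ₗ[F] _) := by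
  rw [LinearMap.exact_iff, ← innerLieDerivations_eq_range]
  exact Submodule.ker_mkQ _

end Derivations

section Product

open TensorProduct

variable {F G H V W : Type*} [Field F] [LieRing G] [LieAlgebra F G] [LieRing H] [LieAlgebra F H]
  [AddCommGroup V] [Module F V] [LieRingModule G V] [LieModule F G V]
  [AddCommGroup W] [Module F W] [LieRingModule H W] [LieModule F H W]

theorem prod_lie_tensor (x : G × H) (u : V ⊗[F] W) :
    ⁅x, u⁆ = map (LieModule.toEnd F G V x.1) .id u + map .id (LieModule.toEnd F H W x.2) u := by
  induction u with
  | zero => simp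
  | tmul v w => exact LieModule.lie_tmul_right x v w
  | add u v hu hv => rw [lie_add, hu, hv, map_add, map_add]; abel

/-- The derivation on `G × H` attached to a degree one cocycle of the tensor product of the
complexes `V → Der(G, V)` and `W → Der(H, W)`. -/
noncomputable def derivationOfCocycle (a : LieDerivation F G V ⊗[F] W)
    (b : V ⊗[F] LieDerivation F H W)
    (hab : map .id (LieDerivation.inner F H W) a = map (LieDerivation.inner F G V) .id b) :
    LieDerivation F (G × H) (V ⊗[F] W) where
  toFun x := map (LieDerivation.evalAt x.1) .id a + map .id (LieDerivation.evalAt x.2) b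
  map_add' x y := by
    simp only [Prod.fst_add, Prod.snd_add, LieDerivation.evalAt_add, map_add_left,
      map_add_right, LinearMap.add_apply]
    abel
  map_smul' c x := by
    simp only [Prod.smul_fst, Prod.smul_snd, LieDerivation.evalAt_smul, map_smul_left,
      map_smul_right, LinearMap.smul_apply, smul_add, RingHom.id_apply]
  leibniz' x y := by
    have key (x : G) (y : H) : map (LieDerivation.evalAt x) (LieModule.toEnd F H W y) a =
        map (LieModule.toEnd F G V x) (LieDerivation.evalAt y) b := by
      have := congrArg (map (LieDerivation.evalAt x) (LieDerivation.evalAt y)) hab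
      simpa only [map_map, LieDerivation.evalAt_comp_inner, LinearMap.comp_id] using this
    have hfst : (⁅x, y⁆ : G × H).1 = ⁅x.1, y.1⁆ := rfl
    have hsnd : (⁅x, y⁆ : G × H).2 = ⁅x.2, y.2⁆ := rfl
    have hleft (p q : LieDerivation F G V →ₗ[F] V) :
        map (p - q) (.id : W →ₗ[F] W) = map p .id - map q .id := LinearMap.rTensor_sub p q
    have hright (p q : LieDerivation F H W →ₗ[F] W) :
        map (.id : V →ₗ[F] V) (p - q) = map .id p - map .id q := LinearMap.lTensor_sub p q
    change map _ _ a + map _ _ b = ⁅x, map _ _ a + map _ _ b⁆ - ⁅y, map _ _ a + map _ _ b⁆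
    simp only [prod_lie_tensor, hfst, hsnd, LieDerivation.evalAt_lie, hleft, hright,
      LinearMap.sub_apply, map_add, map_map, LinearMap.id_comp, LinearMap.comp_id, key]
    abel

theorem derivationOfCocycle_apply (a : LieDerivation F G V ⊗[F] W)
    (b : V ⊗[F] LieDerivation F H W)
    (hab : map .id (LieDerivation.inner F H W) a = map (LieDerivation.inner F G V) .id b)
    (x : G × H) :
    derivationOfCocycle a b hab x =
      map (LieDerivation.evalAt x.1) .id a + map .id (LieDerivation.evalAt x.2) b := rfl

/-- The map sending a degree one cocycle of the tensor product of the complexes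
`V → Der(G, V)` and `W → Der(H, W)` to the attached derivation, as a linear map. -/
noncomputable def prodDerivation :
    tensorCocycles (LieDerivation.inner F G V) (LieDerivation.inner F H W) →ₗ[F]
      LieDerivation F (G × H) (V ⊗[F] W) where
  toFun z := derivationOfCocycle z.1.1 z.1.2 z.2
  map_add' z w := by
    ext x
    simp only [LieDerivation.add_apply, derivationOfCocycle_apply, Submodule.coe_add,
      Prod.fst_add, Prod.snd_add, map_add]
    exact add_add_add_comm _ _ _ _
  map_smul' c z := by
    ext x
    simp only [LieDerivation.smul_apply, derivationOfCocycle_apply, Submodule.coe_smul,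
      Prod.smul_fst, Prod.smul_snd, map_smul, ← smul_add, RingHom.id_apply]
    rfl

theorem prodDerivation_apply
    (z : tensorCocycles (LieDerivation.inner F G V) (LieDerivation.inner F H W)) (x : G × H) :
    prodDerivation z x =
      map (LieDerivation.evalAt x.1) .id z.1.1 + map .id (LieDerivation.evalAt x.2) z.1.2 := rfl

theorem prodDerivation_injective :
    Function.Injective (prodDerivation (F := F) (G := G) (H := H) (V := V) (W := W)) := by
  rw [injective_iff_map_eq_zero]
  rintro ⟨⟨a, b⟩, hab⟩ hz
  have ha : a = 0 := by
    refine eq_zero_of_forall_rTensor (fun x : G => LieDerivation.evalAt x)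
      (fun d hd => LieDerivation.ext hd) a fun x => ?_
    simpa [prodDerivation_apply, LieDerivation.evalAt_zero] using LieDerivation.congr_fun hz (x, 0)
  have hb : b = 0 := by
    refine eq_zero_of_forall_lTensor (fun x : H => LieDerivation.evalAt x)
      (fun d hd => LieDerivation.ext hd) b fun x => ?_
    simpa [prodDerivation_apply, LieDerivation.evalAt_zero] using LieDerivation.congr_fun hz (0, x)
  subst ha hb
  rfl

theorem prodDerivation_surjective [FiniteDimensional F V] [FiniteDimensional F W] :
    Function.Surjective (prodDerivation (F := F) (G := G) (H := H) (V := V) (W := W)) := by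
  intro d
  have hinl (x y : G) : ((⁅x, y⁆, 0) : G × H) = ⁅((x, 0) : G × H), ((y, 0) : G × H)⁆ :=
    Prod.ext rfl (lie_self (0 : H)).symm
  have hinr (x y : H) : ((0, ⁅x, y⁆) : G × H) = ⁅((0, x) : G × H), ((0, y) : G × H)⁆ :=
    Prod.ext (lie_self (0 : G)).symm rfl
  obtain ⟨a, ha⟩ := exists_tensor_evalAt_eq (G := G) (d.toLinearMap ∘ₗ .inl F G H) fun x y => by
    change d (⁅x, y⁆, 0) = map _ _ (d (y, 0)) - map _ _ (d (x, 0))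
    rw [hinl, LieDerivation.apply_lie_eq_sub, prod_lie_tensor, prod_lie_tensor]
    simp
  obtain ⟨b', hb'⟩ := exists_tensor_evalAt_eq (G := H)
    ((TensorProduct.comm F V W).toLinearMap ∘ₗ d.toLinearMap ∘ₗ .inr F G H) fun x y => by
      change TensorProduct.comm F V W (d (0, ⁅x, y⁆)) =
        map _ _ (TensorProduct.comm F V W (d (0, y))) -
          map _ _ (TensorProduct.comm F V W (d (0, x)))
      rw [hinr, LieDerivation.apply_lie_eq_sub, prod_lie_tensor, prod_lie_tensor, map_comm,
        map_comm]
      simp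
  replace ha (x : G) : map (LieDerivation.evalAt x) .id a = d (x, 0) := ha x
  obtain ⟨b, rfl⟩ := (TensorProduct.comm F V (LieDerivation F H W)).surjective b'
  have hb (y : H) : map .id (LieDerivation.evalAt y) b = d (0, y) := by
    have := hb' y
    rw [map_comm] at this
    exact (TensorProduct.comm F V W).injective this
  have hab : map .id (LieDerivation.inner F H W) a = map (LieDerivation.inner F G V) .id b := by
    rw [← sub_eq_zero]
    refine eq_zero_of_forall_rTensor (fun x : G => LieDerivation.evalAt x)
      (fun d hd => LieDerivation.ext hd) _ fun x => ?_
    refine eq_zero_of_forall_lTensor (fun y : H => LieDerivation.evalAt y)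
      (fun d hd => LieDerivation.ext hd) _ fun y => ?_
    have hcomm : ⁅((x, 0) : G × H), ((0, y) : G × H)⁆ = 0 :=
      Prod.ext (lie_zero x) (zero_lie y)
    have h := d.apply_lie_eq_sub (x, 0) (0, y)
    rw [hcomm, map_zero, prod_lie_tensor, prod_lie_tensor, ← ha, ← hb] at h
    simp only [map_map, LinearMap.id_comp, LinearMap.comp_id, map_zero, map_zero_left,
      map_zero_right, LinearMap.zero_apply, add_zero, zero_add] at h
    simp only [map_sub, map_map, LieDerivation.evalAt_comp_inner, LinearMap.id_comp,
      LinearMap.comp_id]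
    rw [← neg_sub, ← h, neg_zero]
  refine ⟨⟨(a, b), hab⟩, LieDerivation.ext fun x => ?_⟩
  rw [prodDerivation_apply, ha, hb, ← map_add]
  simp

theorem prodDerivation_tensorDifferential (u : V ⊗[F] W)
    (hu : tensorDifferential (LieDerivation.inner F G V) (LieDerivation.inner F H W) u ∈
      tensorCocycles (LieDerivation.inner F G V) (LieDerivation.inner F H W)) :
    prodDerivation ⟨_, hu⟩ = LieDerivation.inner F (G × H) (V ⊗[F] W) u := by
  ext x
  rw [prodDerivation_apply, LieDerivation.inner_apply_apply]
  change map _ _ (map _ _ u) + map _ _ (map _ _ u) = ⁅x, u⁆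
  rw [map_map, map_map, LieDerivation.evalAt_comp_inner, LieDerivation.evalAt_comp_inner,
    prod_lie_tensor]
  rfl

theorem map_prodDerivation_range_tensorDifferential :
    ((LinearMap.range (tensorDifferential (LieDerivation.inner F G V)
      (LieDerivation.inner F H W))).comap (Submodule.subtype _)).map prodDerivation =
      innerLieDerivations F (G × H) (V ⊗[F] W) := by
  rw [innerLieDerivations_eq_range]
  ext d
  constructor
  · rintro ⟨⟨_, hz⟩, ⟨u, rfl⟩, rfl⟩
    exact ⟨u, (prodDerivation_tensorDifferential u hz).symm⟩
  · rintro ⟨u, rfl⟩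
    exact ⟨⟨_, tensorDifferential_mem_tensorCocycles _ _ u⟩, ⟨u, rfl⟩,
      prodDerivation_tensorDifferential u _⟩

end Product

/-- For `L = L₁ × L₂` and finite-dimensional modules `M₁` over `L₁` and
`M₂` over `L₂`, regarding `M₁ ⊗ M₂` as an `L`-module via
`(x₁,x₂) • (m₁ ⊗ m₂) = (x₁ • m₁) ⊗ m₂ + m₁ ⊗ (x₂ • m₂)`, there is a `k`-linear isomorphism
`H¹(L, M₁ ⊗ M₂) ≅ (M₁^{L₁} ⊗ H¹(L₂,M₂)) ⊕ (H¹(L₁,M₁) ⊗ M₂^{L₂})`. -/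
theorem lieH1_prod_tensor [FiniteDimensional k M₁] [FiniteDimensional k M₂]
    (hbracket : ∀ (x : L₁ × L₂) (m₁ : M₁) (m₂ : M₂),
      ⁅x, m₁ ⊗ₜ[k] m₂⁆ = ⁅x.1, m₁⁆ ⊗ₜ[k] m₂ + m₁ ⊗ₜ[k] ⁅x.2, m₂⁆) :
    Nonempty (lieH1 k (L₁ × L₂) (M₁ ⊗[k] M₂) ≃ₗ[k]
      (↥(LieModule.maxTrivSubmodule k L₁ M₁) ⊗[k] lieH1 k L₂ M₂) ×
        (lieH1 k L₁ M₁ ⊗[k] ↥(LieModule.maxTrivSubmodule k L₂ M₂))) := by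
  obtain ⟨Φ, hΦ, hker⟩ := exists_tensorCocycles_kunneth
    (Submodule.injective_subtype (LieModule.maxTrivSubmodule k L₁ M₁).toSubmodule)
    exact_subtype_maxTrivSubmodule_inner exact_inner_lieH1_mk lieH1.mk_surjective
    (Submodule.injective_subtype (LieModule.maxTrivSubmodule k L₂ M₂).toSubmodule)
    exact_subtype_maxTrivSubmodule_inner exact_inner_lieH1_mk lieH1.mk_surjective
  exact ⟨(Submodule.Quotient.equiv _ _
    (LinearEquiv.ofBijective prodDerivation ⟨prodDerivation_injective, prodDerivation_surjective⟩)
    (hker ▸ map_prodDerivation_range_tensorDifferential)).symm ≪≫ₗ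
      Φ.quotKerEquivOfSurjective hΦ⟩
end

section
/- Let s be a finite-dimensional semisimple Lie algebra over an algebraically closed field k of characteristic 0, with fixed Cartan subalgebra, positive system, weight lattice P, root lattice Q, and dominant integral weights P⁺. Let U be a finite-dimensional faithful s-module (the representation s → End_k(U) is injective). Then Q ⊆ Span_ℤ wt(U) ⊆ P, and for all λ, μ ∈ P⁺ the following are equivalent: (1) there exist n ≥ 0 and irreducible finite-dimensional s-modules X₀, X₁, …, Xₙ whose highest weights are λ = λ₀, λ₁, …, λₙ = μ and such that Hom_s(U ⊗ X_i, X_{i+1}) ≠ 0 for all 0 ≤ i < n; (2) μ − λ ∈ Span_ℤ wt(U), the ℤ-span of the set of weights of U. -/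
open scoped TensorProduct

universe u

variable (k s : Type u) [Field k] [IsAlgClosed k] [CharZero k]
  [LieRing s] [LieAlgebra k s] [FiniteDimensional k s] [LieAlgebra.IsSemisimple k s]
variable (H : LieSubalgebra k s) [H.IsCartanSubalgebra]

/-- The weight space of a module `M` for a linear functional `χ` on the Cartan subalgebra
`H`: the set of `m` with `x • m = χ(x) m` for all `x ∈ H`. -/
def wtSpace (M : Type u) [AddCommGroup M] [Module k M] [LieRingModule s M]
    [LieModule k s M] (χ : Module.Dual k ↥H) : Submodule k M where
  carrier := {m | ∀ x : ↥H, ⁅(x : s), m⁆ = χ x • m}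
  add_mem' := by intro a b ha hb x; rw [lie_add, ha x, hb x, smul_add]
  zero_mem' := by intro x; simp
  smul_mem' := by intro c m hm x; rw [lie_smul, hm x, smul_comm]

/-- `χ` is a weight of `M` if the corresponding weight space is nonzero. -/
def IsWeightOf (M : Type u) [AddCommGroup M] [Module k M] [LieRingModule s M]
    [LieModule k s M] (χ : Module.Dual k ↥H) : Prop :=
  wtSpace k s H M χ ≠ ⊥

/-- The roots of `s` relative to `H`: the nonzero weights of the adjoint module. -/
def IsRoot (χ : Module.Dual k ↥H) : Prop :=
  χ ≠ 0 ∧ IsWeightOf k s H s χ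

/-- The root lattice `Q`: the additive subgroup of `(H)^*` generated by the roots. -/
def rootLattice : AddSubgroup (Module.Dual k ↥H) :=
  AddSubgroup.closure {χ | IsRoot k s H χ}

/-- A positive system of roots: a set of roots such that exactly one of `±α` is positive for
every root `α`, and which is closed under addition of roots. -/
def IsPositiveSystem (Pos : Set (Module.Dual k ↥H)) : Prop :=
  (∀ χ ∈ Pos, IsRoot k s H χ) ∧
  (∀ χ, IsRoot k s H χ → (χ ∈ Pos ↔ ¬ (-χ ∈ Pos))) ∧
  (∀ α ∈ Pos, ∀ β ∈ Pos, IsRoot k s H (α + β) → α + β ∈ Pos)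

/-- `lam` is the highest weight of the module `M` relative to the positive system `Pos`:
it is a weight, and every weight of `M` is obtained from it by subtracting positive roots. -/
def IsHighestWeightOf (Pos : Set (Module.Dual k ↥H))
    (M : Type u) [AddCommGroup M] [Module k M] [LieRingModule s M] [LieModule k s M]
    (lam : Module.Dual k ↥H) : Prop :=
  IsWeightOf k s H M lam ∧
    ∀ χ, IsWeightOf k s H M χ → lam - χ ∈ AddSubmonoid.closure Pos

/-- `σ` is the reflection in the Weyl group attached to a root `α`: an involution sending
`α` to `-α`, moving every functional along `α` only, and preserving the set of roots. -/
def IsWeylReflection (σ : Module.Dual k ↥H ≃ₗ[k] Module.Dual k ↥H) : Prop :=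
  ∃ α, IsRoot k s H α ∧ σ α = -α ∧ σ * σ = 1 ∧
    (∀ χ, ∃ c : k, χ - σ χ = c • α) ∧ (∀ β, IsRoot k s H β → IsRoot k s H (σ β))

/-- The Weyl group `W(s)`, as the group of automorphisms of `(H)^*` generated by the
reflections in the roots. -/
def weylGroup : Subgroup (Module.Dual k ↥H ≃ₗ[k] Module.Dual k ↥H) :=
  Subgroup.closure {σ | IsWeylReflection k s H σ}

/-- A bundled Lie module over `s`. -/
structure LieModuleBundle : Type (u + 1) where
  carrier : Type u
  [addCommGroup : AddCommGroup carrier]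
  [module : Module k carrier]
  [lieRingModule : LieRingModule s carrier]
  [lieModule : LieModule k s carrier]

attribute [instance] LieModuleBundle.addCommGroup LieModuleBundle.module
  LieModuleBundle.lieRingModule LieModuleBundle.lieModule

/-- The weight lattice `P`: the set of integral weights, i.e. those functionals on `H`
which occur as a weight of some finite-dimensional `s`-module. -/
def IsIntegralWeight (χ : Module.Dual k ↥H) : Prop :=
  ∃ B : LieModuleBundle k s, FiniteDimensional k B.carrier ∧ IsWeightOf k s H B.carrier χ

/-- `lam` is a dominant integral weight (`lam ∈ P⁺`): it is the highest weight of some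
irreducible finite-dimensional `s`-module. -/
def IsDominant (Pos : Set (Module.Dual k ↥H)) (lam : Module.Dual k ↥H) : Prop :=
  ∃ B : LieModuleBundle k s, LieModule.IsIrreducible k s B.carrier ∧
    FiniteDimensional k B.carrier ∧ IsHighestWeightOf k s H Pos B.carrier lam

set_option linter.unusedSectionVars false

section Weyl
open LieModule Module

variable {K L : Type*} [Field K] [LieRing L] [LieAlgebra K L]
  [LieAlgebra.IsSemisimple K L]

theorem LieIdeal.le_lie_self (I : LieIdeal K L) : I ≤ ⁅I, I⁆ := by
  set J := ⁅I, I⁆ with hJ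
  have hab : I ⊓ Jᶜ = ⊥ := by
    refine (LieAlgebra.hasTrivialRadical_iff_no_abelian_ideals K L).1 inferInstance _ ?_
    rw [LieSubmodule.lie_abelian_iff_lie_self_eq_bot, eq_bot_iff]
    calc ⁅I ⊓ Jᶜ, I ⊓ Jᶜ⁆ ≤ J ⊓ Jᶜ :=
          le_inf (LieSubmodule.mono_lie inf_le_left inf_le_left)
            ((LieSubmodule.lie_le_right _ _).trans inf_le_right)
      _ = ⊥ := inf_compl_self J
  rw [← disjoint_iff] at hab
  exact disjoint_compl_right_iff.1 hab

variable {M : Type*} [AddCommGroup M] [Module K M] [LieRingModule L M] [LieModule K L M]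

theorem lie_mem_lie_lie {I : LieIdeal K L} {y : L} (hy : y ∈ ⁅I, I⁆) (m : M) :
    ⁅y, m⁆ ∈ ⁅I, ⁅I, (⊤ : LieSubmodule K L M)⁆⁆ := by
  rw [← LieSubmodule.mem_toSubmodule, LieSubmodule.lieIdeal_oper_eq_linear_span'] at hy
  induction hy using Submodule.span_induction with
  | mem w hw =>
    obtain ⟨a, ha, b, hb, rfl⟩ := hw
    rw [lie_lie]
    exact sub_mem
      (LieSubmodule.lie_mem_lie ha (LieSubmodule.lie_mem_lie hb (LieSubmodule.mem_top m)))
      (LieSubmodule.lie_mem_lie hb (LieSubmodule.lie_mem_lie ha (LieSubmodule.mem_top m)))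
  | zero => simp
  | add a b _ _ ha hb => rw [add_lie]; exact add_mem ha hb
  | smul c a _ ha => rw [smul_lie]; exact SMulMemClass.smul_mem c ha

variable [CharZero K]

theorem lie_eq_zero_of_forall_traceForm_eq_zero [FiniteDimensional K M] {x : L}
    (hx : ∀ y, traceForm K L M x y = 0) (m : M) : ⁅x, m⁆ = 0 := by
  let I : LieIdeal K L :=
    { LinearMap.ker (traceForm K L M) with
      lie_mem := by
        intro y z hz
        replace hz : traceForm K L M z = 0 := hz
        change traceForm K L M ⁅y, z⁆ = 0
        ext w
        rw [← lie_skew, map_neg, LinearMap.neg_apply, traceForm_apply_lie_apply, hz]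
        simp }
  have hxI : x ∈ I := by
    change traceForm K L M x = 0
    ext y; exact hx y
  have hI : traceForm K I M = 0 := by
    ext y z
    have : traceForm K L M y.1 = 0 := y.2
    exact LinearMap.congr_fun this z.1
  have hnil := isNilpotent_derivedSeries_of_traceForm_eq_zero hI
  have htop : LieAlgebra.derivedSeries K I 1 = ⊤ := by
    have h1 := LieIdeal.derivedSeries_eq_derivedSeriesOfIdeal_comap I 1
    rw [h1, LieAlgebra.derivedSeriesOfIdeal_succ, LieAlgebra.derivedSeriesOfIdeal_zero, eq_top_iff]
    intro z _
    exact LieIdeal.le_lie_self I z.2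
  have hnil' : IsNilpotent I M := by
    rw [isNilpotent_iff_forall' (R := K)] at hnil ⊢
    intro z
    exact hnil ⟨z, htop ▸ LieSubmodule.mem_top z⟩
  obtain ⟨n, hn⟩ := IsNilpotent.nilpotent K I M
  have hlcs : I.lcs M n = ⊥ := by
    have := LieIdeal.coe_lcs_eq (R := K) (M := M) I n
    rw [hn] at this
    simpa using this
  have key : ∀ j, ⁅I, (⊤ : LieSubmodule K L M)⁆ ≤ I.lcs M j := by
    intro j
    induction j with
    | zero => simp
    | succ j ih =>
      rw [LieIdeal.lcs_succ]
      refine le_trans ?_ (LieSubmodule.mono_lie le_rfl ih)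
      rw [LieSubmodule.lieIdeal_oper_eq_span, LieSubmodule.lieSpan_le]
      rintro _ ⟨⟨y, hy⟩, ⟨m, hm⟩, rfl⟩
      exact lie_mem_lie_lie (LieIdeal.le_lie_self I hy) m
  have := key n (LieSubmodule.lie_mem_lie hxI (LieSubmodule.mem_top m))
  rw [hlcs] at this
  simpa using this


theorem exists_casimir [FiniteDimensional K M] :
    ∃ c : M →ₗ⁅K,L⁆ M, (∀ N : LieSubmodule K L M, (∀ (x : L) (m : M), ⁅x, m⁆ ∈ N) →
      ∀ m, c m ∈ N) ∧ (∀ (N : LieSubmodule K L M) (m), m ∈ N → c m ∈ N) ∧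
      LinearMap.trace K M c =
        (finrank K (LinearMap.range (toEnd K L M : L →ₗ[K] End K M)) : K) := by
  set 𝔤 := LinearMap.range (toEnd K L M : L →ₗ[K] End K M) with h𝔤
  let B : LinearMap.BilinForm K 𝔤 :=
    (LinearMap.BilinForm.restrict (LinearMap.compr₂ (LinearMap.mul K (End K M))
      (LinearMap.trace K M)) 𝔤)
  have hB : ∀ a b : 𝔤, B a b = LinearMap.trace K M (a.1 * b.1) := fun a b => rfl
  have hBs : B.IsSymm := ⟨fun a b => by
    rw [hB, hB, LinearMap.trace_mul_comm]⟩
  have hsymm : ∀ a d, B a d = B d a := fun a d => by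
    rw [hB, hB, LinearMap.trace_mul_comm]
  have hBn : B.Nondegenerate := by
    refine hBs.isRefl.nondegenerate_iff_separatingLeft.2 ?_
    rintro ⟨_, x, rfl⟩ hx
    ext m
    refine lie_eq_zero_of_forall_traceForm_eq_zero (K := K) (fun y => ?_) m
    exact hx ⟨_, y, rfl⟩
  let b := finBasis K 𝔤
  let b' := B.dualBasis hBn b
  have e1 : ∀ a : 𝔤, a = ∑ j, B a (b' j) • b j := by
    intro a
    conv_lhs => rw [← b.sum_repr a]
    refine Finset.sum_congr rfl fun j _ => ?_
    congr 1
    conv_rhs => rw [← b.sum_repr a]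
    simp only [map_sum, LinearMap.sum_apply, map_smul, LinearMap.smul_apply, b',
      LinearMap.BilinForm.apply_dualBasis_right hBn hBs]
    simp
  have e2 : ∀ a : 𝔤, a = ∑ j, B a (b j) • b' j := by
    intro a
    conv_lhs => rw [← b'.sum_repr a]
    simp [b', LinearMap.BilinForm.dualBasis_repr_apply]
  let c : End K M := ∑ i, (b i).1 * (b' i).1
  have hc : ∀ m, c m = ∑ i, (b i).1 ((b' i).1 m) := by
    intro m
    simp [c, LinearMap.sum_apply]
  have hcomm : ∀ x : L, toEnd K L M x * c - c * toEnd K L M x = 0 := by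
    intro x
    set X := toEnd K L M x with hX
    have hmem : ∀ a : 𝔤, X * a.1 - a.1 * X ∈ 𝔤 := by
      rintro ⟨_, y, rfl⟩
      exact ⟨⁅x, y⁆, by simp [hX, LieRing.of_associative_ring_bracket]⟩
    let f : 𝔤 → 𝔤 := fun a => ⟨X * a.1 - a.1 * X, hmem a⟩
    have hf : ∀ a, (f a).1 = X * a.1 - a.1 * X := fun a => rfl
    have hinv : ∀ a d, B (f a) d = - B a (f d) := by
      intro a d
      rw [hB, hB, hf, hf, sub_mul, mul_sub, map_sub, map_sub, neg_sub, mul_assoc X,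
        LinearMap.trace_mul_comm K X, mul_assoc, mul_assoc]
    have h1 : X * c - c * X = ∑ i, ((f (b i)).1 * (b' i).1 + (b i).1 * (f (b' i)).1) := by
      simp only [c, Finset.mul_sum, Finset.sum_mul, ← Finset.sum_sub_distrib, hf]
      refine Finset.sum_congr rfl fun i _ => ?_
      noncomm_ring
    rw [h1, Finset.sum_add_distrib]
    have h2 : ∑ i, (f (b i)).1 * (b' i).1 =
        ∑ i, ∑ j, B (f (b i)) (b' j) • ((b j).1 * (b' i).1) := by
      refine Finset.sum_congr rfl fun i _ => ?_
      conv_lhs => rw [e1 (f (b i))]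
      simp [Finset.sum_mul]
    have h3 : ∑ i, (b i).1 * (f (b' i)).1 =
        ∑ i, ∑ j, B (f (b' i)) (b j) • ((b i).1 * (b' j).1) := by
      refine Finset.sum_congr rfl fun i _ => ?_
      conv_lhs => rw [e2 (f (b' i))]
      simp [Finset.mul_sum]
    rw [h2, h3, Finset.sum_comm, ← Finset.sum_add_distrib]
    refine Finset.sum_eq_zero fun i _ => ?_
    rw [← Finset.sum_add_distrib]
    refine Finset.sum_eq_zero fun j _ => ?_
    rw [← add_smul, hinv, hsymm (b j), neg_add_cancel, zero_smul]
  refine ⟨{ c with map_lie' := ?_ }, ?_, ?_, ?_⟩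
  · intro x m
    have := LinearMap.congr_fun (hcomm x) m
    simp only [LinearMap.sub_apply, Module.End.mul_apply, LinearMap.zero_apply, sub_eq_zero] at this
    exact this.symm
  · intro N hN m
    change c m ∈ N
    rw [hc]
    refine sum_mem fun i _ => ?_
    obtain ⟨x, hx⟩ := (b i).2
    rw [← hx]
    exact hN _ _
  · intro N m hm
    change c m ∈ N
    rw [hc]
    refine sum_mem fun i _ => ?_
    obtain ⟨x, hx⟩ := (b i).2
    obtain ⟨y, hy⟩ := (b' i).2
    rw [← hx, ← hy]
    exact N.lie_mem (N.lie_mem hm)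
  · change LinearMap.trace K M c = _
    have h1 : ∀ i, LinearMap.trace K M ((b i).1 * (b' i).1) = 1 := by
      intro i
      rw [← hB]
      simp [b', LinearMap.BilinForm.apply_dualBasis_right hBn hBs]
    simp [c, h1]

theorem exists_invariant_of_irreducible [FiniteDimensional K M] (N : LieSubmodule K L M)
    (hN : ∀ (x : L) (m : M), ⁅x, m⁆ ∈ N) (hirr : ∀ N' ≤ N, N' = ⊥ ∨ N' = N) (m : M) :
    ∃ m', m - m' ∈ N ∧ ∀ x : L, ⁅x, m'⁆ = 0 := by
  by_cases htriv : ∀ (x : L) (m : M), ⁅x, m⁆ = 0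
  · exact ⟨m, by simp, fun x => htriv x m⟩
  obtain ⟨c, hc1, hc2, hc3⟩ := exists_casimir (K := K) (L := L) (M := M)
  rcases hirr (c.ker ⊓ N) inf_le_right with h | h
  · have hinj : ∀ n ∈ N, c n = 0 → n = 0 := by
      intro n hn hcn
      have : n ∈ c.ker ⊓ N := ⟨by simpa using hcn, hn⟩
      rw [h] at this
      simpa using this
    let f : N →ₗ[K] N := (c : M →ₗ[K] M).restrict (p := N.toSubmodule) (q := N.toSubmodule)
      (fun n hn => hc2 N n hn)
    have hf : Function.Surjective f := by
      rw [← LinearMap.injective_iff_surjective, injective_iff_map_eq_zero]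
      intro n hn
      ext
      exact hinj n.1 n.2 (congrArg Subtype.val hn)
    obtain ⟨n, hn⟩ := hf ⟨c m, hc1 N hN m⟩
    have hn' : c n.1 = c m := congrArg Subtype.val hn
    refine ⟨m - n.1, by simp, fun x => hinj _ (hN _ _) ?_⟩
    rw [LieModuleHom.map_lie, map_sub, hn', sub_self, lie_zero]
  · exfalso
    have hnil : IsNilpotent (c : M →ₗ[K] M) := by
      refine ⟨2, LinearMap.ext fun m => ?_⟩
      have : c m ∈ c.ker ⊓ N := by rw [h]; exact hc1 N hN m
      have := this.1
      rw [pow_two]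
      simpa using this
    have h0 := (LinearMap.isNilpotent_trace_of_isNilpotent hnil).eq_zero
    rw [hc3, Nat.cast_eq_zero, Submodule.finrank_eq_zero, LinearMap.range_eq_bot] at h0
    exact htriv fun x m => LinearMap.congr_fun (LinearMap.congr_fun h0 x) m

theorem exists_invariant_of_minimal [FiniteDimensional K M] (N : LieSubmodule K L M)
    (hirr : ∀ N' ≤ N, N' = ⊥ ∨ N' = N) (m : M) (hm : ∀ x : L, ⁅x, m⁆ ∈ N) :
    ∃ m', m - m' ∈ N ∧ ∀ x : L, ⁅x, m'⁆ = 0 := by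
  let W : LieSubmodule K L M :=
    { carrier := {w | ∀ x : L, ⁅x, w⁆ ∈ N}
      add_mem' := fun ha hb x => by rw [lie_add]; exact add_mem (ha x) (hb x)
      zero_mem' := fun x => by simp
      smul_mem' := fun c w hw x => by rw [lie_smul]; exact SMulMemClass.smul_mem c (hw x)
      lie_mem := fun {x w} hw y => N.lie_mem (hw x) }
  have hNW : N ≤ W := fun n hn x => N.lie_mem hn
  have hirr' : ∀ N' ≤ N.comap W.incl, N' = ⊥ ∨ N' = N.comap W.incl := by
    intro N' hN'
    have hinj := LieSubmodule.map_injective_of_injective (f := W.incl) W.injective_incl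
    rcases hirr (N'.map W.incl) (LieSubmodule.map_le_iff_le_comap.2 hN') with h | h
    · exact Or.inl (hinj (by rw [h, LieSubmodule.map_bot]))
    · refine Or.inr (le_antisymm hN' fun w hw => ?_)
      have : w.1 ∈ N'.map W.incl := h ▸ hw
      obtain ⟨v, hv, hvw⟩ := this
      exact (Subtype.ext hvw : v = w) ▸ hv
  obtain ⟨m', h1, h2⟩ := exists_invariant_of_irreducible (K := K) (M := W) (N.comap W.incl)
    (fun x w => w.2 x) hirr' ⟨m, hm⟩
  exact ⟨m'.1, h1, fun x => congrArg Subtype.val (h2 x)⟩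

universe v in
theorem exists_invariant_of_finrank_le (n : ℕ) :
    ∀ (M : Type v) [AddCommGroup M] [Module K M] [LieRingModule L M] [LieModule K L M]
      [FiniteDimensional K M] (N : LieSubmodule K L M), finrank K N ≤ n →
      ∀ m, (∀ x : L, ⁅x, m⁆ ∈ N) → ∃ m', m - m' ∈ N ∧ ∀ x : L, ⁅x, m'⁆ = 0 := by
  induction n with
  | zero =>
    intro M _ _ _ _ _ N hN m hm
    refine ⟨m, by simp, fun x => ?_⟩
    have : N.toSubmodule = ⊥ := Submodule.finrank_eq_zero.1 (Nat.le_zero.1 hN)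
    have h := hm x
    rw [← LieSubmodule.mem_toSubmodule, this] at h
    simpa using h
  | succ n ih =>
    intro M _ _ _ _ _ N hN m hm
    by_cases hirr : ∀ N' ≤ N, N' = ⊥ ∨ N' = N
    · exact exists_invariant_of_minimal N hirr m hm
    push Not at hirr
    obtain ⟨N', hle, hbot, hne⟩ := hirr
    have hlt : finrank K N' < finrank K N :=
      Submodule.finrank_lt_finrank_of_lt (s := N'.toSubmodule) (t := N.toSubmodule)
        (lt_of_le_of_ne hle fun h => hne (LieSubmodule.toSubmodule_injective h))
    have hpos : 0 < finrank K N' := by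
      refine Nat.pos_of_ne_zero fun h => hbot ?_
      rw [← LieSubmodule.toSubmodule_eq_bot]
      exact Submodule.finrank_eq_zero.1 h
    let q : M →ₗ⁅K,L⁆ M ⧸ N' := LieSubmodule.Quotient.mk' N'
    have hq : ∀ w, q w = 0 ↔ w ∈ N' := fun w => LieSubmodule.Quotient.mk_eq_zero N'
    have hfr : finrank K (N.map q) ≤ n := by
      let g := (q : M →ₗ[K] M ⧸ N').domRestrict N.toSubmodule
      have h1 := LinearMap.finrank_range_add_finrank_ker g
      have h2 : finrank K (N.map q) = finrank K (LinearMap.range g) := by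
        rw [LinearMap.range_domRestrict]
        rfl
      have h3 : 0 < finrank K (LinearMap.ker g) := by
        rw [finrank_pos_iff_exists_ne_zero]
        obtain ⟨w, hw, hw0⟩ := Submodule.exists_mem_ne_zero_of_ne_bot
          (fun h => hbot ((LieSubmodule.toSubmodule_eq_bot _).1 h))
        exact ⟨⟨⟨w, hle hw⟩, (hq w).2 hw⟩, fun h => hw0 (congrArg (fun z => z.1.1) h)⟩
      have h4 : finrank K N.toSubmodule = finrank K N := rfl
      omega
    obtain ⟨m1, h1, h2⟩ := ih (M ⧸ N') (N.map q) hfr (q m) fun x => by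
      rw [← LieModuleHom.map_lie]
      exact LieSubmodule.mem_map_of_mem (hm x)
    obtain ⟨m1, rfl⟩ := LieSubmodule.Quotient.surjective_mk' N' m1
    obtain ⟨m2, h3, h4⟩ := ih M N' (by omega) m1 fun x => by
      rw [← hq, LieModuleHom.map_lie]
      exact h2 x
    refine ⟨m2, ?_, h4⟩
    obtain ⟨w, hw, hwm⟩ := h1
    have h5 : m - m1 - w ∈ N' := by
      rw [← hq, map_sub, map_sub, sub_eq_zero]
      exact hwm.symm
    have : m - m2 = (m - m1 - w) + w + (m1 - m2) := by abel
    rw [this]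
    exact add_mem (add_mem (hle h5) hw) (hle h3)

theorem exists_projection [FiniteDimensional K M] (N : LieSubmodule K L M) :
    ∃ p : M →ₗ⁅K,L⁆ N, ∀ n : N, p n = n := by
  let S : LieSubmodule K L (M →ₗ[K] N) :=
    { carrier := {f | ∀ n : N, f n = 0}
      add_mem' := fun ha hb x => by simp [ha x, hb x]
      zero_mem' := fun x => by simp
      smul_mem' := fun c w hw x => by simp [hw x]
      lie_mem := fun {x w} hw n => by
        have h1 := hw n
        have h2 := hw ⁅x, n⁆
        rw [LieSubmodule.coe_bracket] at h2
        rw [LieHom.lie_apply, h1, h2]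
        simp }
  obtain ⟨p, hp⟩ := N.toSubmodule.subtype.exists_leftInverse_of_injective
    (by simp)
  let p' : M →ₗ[K] N := p
  have hp' : ∀ n : N, p' n = n := fun n => LinearMap.congr_fun hp n
  obtain ⟨f, hf1, hf2⟩ := exists_invariant_of_finrank_le (K := K) (L := L) _ (M →ₗ[K] N) S
    le_rfl p' fun x n => by
      have h2 := hp' ⁅x, n⁆
      rw [LieSubmodule.coe_bracket] at h2
      rw [LieHom.lie_apply]
      change ⁅x, p' n⁆ - p' ⁅x, n.1⁆ = 0
      rw [hp', h2, sub_self]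
  refine ⟨{ f with map_lie' := fun {x m} => ?_ }, fun n => ?_⟩
  · have := LinearMap.congr_fun (hf2 x) m
    rw [LieHom.lie_apply, LinearMap.zero_apply, sub_eq_zero] at this
    exact this.symm
  · have := hf1 n
    rw [LinearMap.sub_apply, sub_eq_zero] at this
    exact this.symm.trans (hp' n)

theorem exists_isCompl_lieSubmodule [FiniteDimensional K M] (N : LieSubmodule K L M) :
    ∃ N', IsCompl N N' := by
  obtain ⟨p, hp⟩ := exists_projection N
  refine ⟨p.ker, ?_, ?_⟩
  · rw [disjoint_iff, eq_bot_iff]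
    rintro m ⟨h1, h2⟩
    have h3 : p m = 0 := by simpa using h2
    have h4 := hp ⟨m, h1⟩
    rw [h3] at h4
    exact (congrArg Subtype.val h4).symm
  · rw [codisjoint_iff, eq_top_iff]
    intro m _
    rw [LieSubmodule.mem_sup]
    exact ⟨p m, (p m).2, m - p m, by simp [hp], by simp⟩

end Weyl

section Roots
open LieModule Module LieAlgebra LieAlgebra.IsKilling

variable {k s H}

theorem mem_wtSpace_iff_mem_rootSpace {χ : Dual k H} {x : s} :
    x ∈ wtSpace k s H s χ ↔ x ∈ rootSpace H χ :=
  ⟨fun h => weightSpace_le_genWeightSpace s χ ((mem_weightSpace _ _).2 h),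
    fun h => lie_eq_smul_of_mem_rootSpace h⟩

theorem wtSpace_eq_rootSpace (χ : Dual k H) :
    wtSpace k s H s χ = (rootSpace H χ).toSubmodule :=
  Submodule.ext fun _ => mem_wtSpace_iff_mem_rootSpace

theorem isWeightOf_iff_rootSpace_ne_bot {χ : Dual k H} :
    IsWeightOf k s H s χ ↔ rootSpace H χ ≠ ⊥ := by
  rw [IsWeightOf, wtSpace_eq_rootSpace, Ne, LieSubmodule.toSubmodule_eq_bot]

theorem isRoot_iff_exists_weight {χ : Dual k H} :
    IsRoot k s H χ ↔ ∃ α : Weight k H s, α.IsNonZero ∧ α.toLinear = χ := by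
  constructor
  · rintro ⟨h0, hw⟩
    refine ⟨⟨χ, isWeightOf_iff_rootSpace_ne_bot.1 hw⟩, fun h => h0 ?_, rfl⟩
    ext x
    exact congrFun h x
  · rintro ⟨α, h0, rfl⟩
    exact ⟨Weight.coe_toLinear_ne_zero_iff.2 h0,
      isWeightOf_iff_rootSpace_ne_bot.2 α.genWeightSpace_ne_bot⟩

theorem IsRoot.neg {χ : Dual k H} (h : IsRoot k s H χ) : IsRoot k s H (-χ) := by
  obtain ⟨α, h0, rfl⟩ := isRoot_iff_exists_weight.1 h
  exact isRoot_iff_exists_weight.2 ⟨-α, h0.neg, Weight.toLinear_neg⟩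

theorem finite_setOf_isRoot : {χ | IsRoot k s H χ}.Finite := by
  refine (Set.finite_range (fun α : Weight k H s => α.toLinear)).subset fun χ h => ?_
  obtain ⟨α, -, rfl⟩ := isRoot_iff_exists_weight.1 h
  exact ⟨α, rfl⟩

theorem Submodule.exists_smul_eq_of_finrank_one {K V : Type*} [Field K] [AddCommGroup V]
    [Module K V]
    (R : Submodule K V) (h : finrank K R = 1) {e x : V} (he : e ≠ 0) (heR : e ∈ R) (hx : x ∈ R) :
    ∃ c : K, c • e = x := by
  obtain ⟨c, hc⟩ := (finrank_eq_one_iff_of_nonzero' (⟨e, heR⟩ : R)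
    (fun h => he (congrArg Subtype.val h))).1 h ⟨x, hx⟩
  exact ⟨c, congrArg Subtype.val hc⟩

theorem wtSpace_le_span_singleton {χ : Dual k H} (h : IsRoot k s H χ) {e x : s} (he : e ≠ 0)
    (heχ : e ∈ wtSpace k s H s χ) (hx : x ∈ wtSpace k s H s χ) : ∃ c : k, c • e = x := by
  obtain ⟨α, h0, rfl⟩ := isRoot_iff_exists_weight.1 h
  have h1 : finrank k (wtSpace k s H s α.toLinear) = 1 := by
    rw [wtSpace_eq_rootSpace]
    convert! finrank_rootSpace_eq_one α h0
  exact Submodule.exists_smul_eq_of_finrank_one _ h1 he heχ hx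

theorem IsRoot.exists_isSl2Triple {α : Dual k H} (hα : IsRoot k s H α) :
    ∃ (h : H) (e f : s), IsSl2Triple (h : s) e f ∧ e ∈ wtSpace k s H s α ∧
      f ∈ wtSpace k s H s (-α) ∧ α h = 2 ∧ ∀ β, IsRoot k s H β → ∃ m : ℤ, β h = m ∧
        (m < 0 → β + α ≠ 0 → IsRoot k s H (β + α)) ∧
        (m = 0 → ¬ IsRoot k s H (β - α) → ¬ IsRoot k s H (β + α)) := by
  obtain ⟨α, h0, rfl⟩ := isRoot_iff_exists_weight.1 hα
  obtain ⟨h, e, f, ht, he, hf⟩ := exists_isSl2Triple_of_weight_isNonZero h0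
  have hh : h = coroot α := ht.h_eq_coroot h0 he hf
  subst hh
  refine ⟨coroot α, e, f, ht, mem_wtSpace_iff_mem_rootSpace.2 he,
    mem_wtSpace_iff_mem_rootSpace.2 hf, root_apply_coroot h0, fun β hβ => ?_⟩
  obtain ⟨β, h1, rfl⟩ := isRoot_iff_exists_weight.1 hβ
  have key : ∀ n : ℤ, IsWeightOf k s H s (β.toLinear + n • α.toLinear) ↔
      n ≤ chainTopCoeff α β ∧ -n ≤ chainBotCoeff α β := by
    intro n
    rw [← rootSpace_zsmul_add_ne_bot_iff α β h0, isWeightOf_iff_rootSpace_ne_bot, add_comm]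
    rfl
  refine ⟨chainBotCoeff α β - chainTopCoeff α β, apply_coroot_eq_cast α β, fun hm hne => ?_,
    fun hm hn hp => ?_⟩
  · refine ⟨hne, ?_⟩
    have := (key 1).2 (by omega)
    rwa [one_smul] at this
  · have hp' := (key 1).1 (by rw [one_smul]; exact hp.2)
    refine hn ⟨fun h => ?_, ?_⟩
    · rw [sub_eq_zero] at h
      have h2 : β (coroot α) = α (coroot α) := LinearMap.congr_fun h (coroot α)
      rw [root_apply_coroot h0, apply_coroot_eq_cast, hm] at h2
      simp at h2
    · have := (key (-1)).2 (by omega)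
      rwa [neg_smul, one_smul, ← sub_eq_add_neg] at this

theorem lieSubalgebra_eq_top_of_wtSpace_le {S : LieSubalgebra k s}
    (h : ∀ α, IsRoot k s H α → ∀ x ∈ wtSpace k s H s α, x ∈ S) : S = ⊤ := by
  have h1 : ∀ α : Weight k H s, α.IsNonZero → ∀ x ∈ rootSpace H α, x ∈ S := fun α h0 x hx =>
    h _ (isRoot_iff_exists_weight.2 ⟨α, h0, rfl⟩) x (mem_wtSpace_iff_mem_rootSpace.2 hx)
  have h2 : ∀ x ∈ H, x ∈ S := by
    have h3 : (⨆ α : Weight k H s, ⨆ (_ : α.IsNonZero), corootSpace α).toSubmodule ≤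
        S.toSubmodule.comap H.toSubmodule.subtype := by
      simp only [LieSubmodule.iSup_toSubmodule, iSup_le_iff]
      intro α h0
      rw [coe_corootSpace_eq_span_singleton, Submodule.span_singleton_le_iff_mem]
      obtain ⟨h, e, f, ht, he, hf⟩ := exists_isSl2Triple_of_weight_isNonZero h0
      have hh : h = coroot α := ht.h_eq_coroot h0 he hf
      change (coroot α : s) ∈ S
      rw [← hh, ← ht.lie_e_f]
      exact S.lie_mem (h1 α h0 _ he) (h1 (-α) h0.neg _ hf)
    rw [biSup_corootSpace_eq_top] at h3
    exact fun x hx => h3 (show (⟨x, hx⟩ : H) ∈ _ by simp)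
  have h3 : (H.toLieSubmodule ⊔ ⨆ α : Weight k H s, ⨆ (_ : α.IsNonZero), rootSpace H α).toSubmodule
      ≤ S.toSubmodule := by
    simp only [LieSubmodule.sup_toSubmodule, LieSubmodule.iSup_toSubmodule, sup_le_iff, iSup_le_iff]
    exact ⟨h2, h1⟩
  rw [cartan_sup_iSup_rootSpace_eq_top] at h3
  exact eq_top_iff.2 fun x _ => h3 (by simp)

end Roots

section PositiveSystem
open LieModule Module LieAlgebra LieAlgebra.IsKilling

variable {k s H}

theorem lie_mem_wtSpace {M : Type u} [AddCommGroup M] [Module k M] [LieRingModule s M]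
    [LieModule k s M] {α χ : Dual k H} {x : s} {m : M} (hx : x ∈ wtSpace k s H s α)
    (hm : m ∈ wtSpace k s H M χ) : ⁅x, m⁆ ∈ wtSpace k s H M (α + χ) := by
  intro y
  rw [leibniz_lie, hx y, hm y, lie_smul, smul_lie, LinearMap.add_apply, add_smul]

theorem IsRoot.exists_ne_zero {α : Dual k H} (h : IsRoot k s H α) :
    ∃ e ∈ wtSpace k s H s α, e ≠ 0 :=
  Submodule.exists_mem_ne_zero_of_ne_bot h.2

theorem lie_ne_zero_of_isRoot_add {α β : Dual k H} (hα : IsRoot k s H α) (hβ : IsRoot k s H β)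
    (hαβ : IsRoot k s H (α + β)) {x y : s} (hx : x ∈ wtSpace k s H s α) (hx0 : x ≠ 0)
    (hy : y ∈ wtSpace k s H s β) (hy0 : y ≠ 0) : ⁅x, y⁆ ≠ 0 := by
  intro hxy
  obtain ⟨h, e, f, ht, he, hf, hh, -⟩ := hα.exists_isSl2Triple
  obtain ⟨c, rfl⟩ := wtSpace_le_span_singleton hα hx0 hx he
  have hcy : ⁅c • x, y⁆ = 0 := by rw [smul_lie, hxy, smul_zero]
  have P1 : ht.HasPrimitiveVectorWith y (β h) := ⟨hy0, hy h, hcy⟩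
  obtain ⟨n, hn⟩ := P1.exists_nat
  obtain ⟨z, hz, hz0⟩ := hαβ.neg.exists_ne_zero
  have hez : ⁅c • x, z⁆ = 0 := by
    have h1 := lie_mem_wtSpace he hz
    rw [neg_add, add_neg_cancel_left, mem_wtSpace_iff_mem_rootSpace] at h1
    have h2 := mem_ker_killingForm_of_mem_rootSpace_of_forall_rootSpace_neg k s H h1 fun w hw => by
      have hw' : w ∈ wtSpace k s H s β := by
        rw [mem_wtSpace_iff_mem_rootSpace]
        convert hw using 2
        ext; simp
      obtain ⟨d, rfl⟩ := wtSpace_le_span_singleton hβ hy0 hy hw'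
      rw [map_smul, ← lie_skew, map_neg, LinearMap.neg_apply, traceForm_apply_lie_apply, hcy]
      simp
    simpa using h2
  have P2 : ht.HasPrimitiveVectorWith z ((-(α + β)) h) := ⟨hz0, hz h, hez⟩
  obtain ⟨n', hn'⟩ := P2.exists_nat
  have : ((n' + n + 2 : ℕ) : k) = 0 := by
    push_cast
    rw [← hn, ← hn', LinearMap.neg_apply, LinearMap.add_apply, hh]
    ring
  exact absurd (Nat.cast_eq_zero.1 this) (by omega)

theorem exists_lie_eq_of_isRoot_add {α β : Dual k H} (hα : IsRoot k s H α) (hβ : IsRoot k s H β)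
    (hαβ : IsRoot k s H (α + β)) {z : s} (hz : z ∈ wtSpace k s H s (α + β)) :
    ∃ x ∈ wtSpace k s H s α, ∃ y ∈ wtSpace k s H s β, ⁅x, y⁆ = z := by
  obtain ⟨x, hx, hx0⟩ := hα.exists_ne_zero
  obtain ⟨y, hy, hy0⟩ := hβ.exists_ne_zero
  obtain ⟨c, hc⟩ := wtSpace_le_span_singleton hαβ
    (lie_ne_zero_of_isRoot_add hα hβ hαβ hx hx0 hy hy0) (lie_mem_wtSpace hx hy) hz
  exact ⟨c • x, Submodule.smul_mem _ _ hx, y, hy, by rw [smul_lie, hc]⟩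

variable {Pos : Set (Dual k H)}

theorem IsPositiveSystem.sum_ne_zero (hPos : IsPositiveSystem k s H Pos) (n : ℕ) :
    ∀ S : Multiset (Dual k H), S.card = n + 1 → (∀ α ∈ S, α ∈ Pos) → S.sum ≠ 0 := by
  induction n with
  | zero =>
    intro S hS hSP
    obtain ⟨a, rfl⟩ := Multiset.card_eq_one.1 hS
    simpa using (hPos.1 a (hSP a (by simp))).1
  | succ n ih =>
    intro S hS hSP h0
    obtain ⟨a, haS⟩ := Multiset.card_pos_iff_exists_mem.1 (by omega : 0 < S.card)
    obtain ⟨T, rfl⟩ := Multiset.exists_cons_of_mem haS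
    have ha := hSP a (by simp)
    have hT : ∀ α ∈ T, α ∈ Pos := fun α hα => hSP α (by simp [hα])
    obtain ⟨h, e, f, -, -, -, hh, hβ⟩ := (hPos.1 a ha).exists_isSl2Triple
    have hex : ∃ b ∈ T, IsRoot k s H (b + a) := by
      by_contra! hno
      have key : ∀ T : Multiset (Dual k H), (∀ α ∈ T, α ∈ Pos) → (∀ b ∈ T, ¬ IsRoot k s H (b + a)) →
          ∃ n : ℕ, T.sum h = n := by
        intro T
        induction T using Multiset.induction with
        | empty => exact fun _ _ => ⟨0, by simp⟩
        | cons b T ih =>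
          intro h1 h2
          obtain ⟨n, hn⟩ := ih (fun α hα => h1 α (by simp [hα])) (fun α hα => h2 α (by simp [hα]))
          have hb := h1 b (by simp)
          obtain ⟨m, hm, hm', -⟩ := hβ b (hPos.1 b hb)
          have hm0 : 0 ≤ m := by
            by_contra! hlt
            refine h2 b (by simp) (hm' hlt fun hba => ?_)
            rw [add_eq_zero_iff_eq_neg] at hba
            subst hba
            exact (hPos.2.1 a (hPos.1 a ha)).1 ha hb
          obtain ⟨m, rfl⟩ := Int.eq_ofNat_of_zero_le hm0
          exact ⟨m + n, by simp [hn, hm]⟩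
      obtain ⟨m, hm⟩ := key T hT hno
      have := LinearMap.congr_fun h0 h
      rw [Multiset.sum_cons, LinearMap.add_apply, hm, hh, LinearMap.zero_apply] at this
      have h2 : ((2 + m : ℕ) : k) = 0 := by exact_mod_cast this
      exact absurd (Nat.cast_eq_zero.1 h2) (by omega)
    obtain ⟨b, hb, hba⟩ := hex
    obtain ⟨T, rfl⟩ := Multiset.exists_cons_of_mem hb
    refine ih ((b + a) ::ₘ T) (by simpa using hS) ?_ ?_
    · intro α hα
      rcases Multiset.mem_cons.1 hα with rfl | hα
      · exact hPos.2.2 _ (hT b hb) _ ha hba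
      · exact hT α (by simp [hα])
    · rw [← h0]
      simp only [Multiset.sum_cons]
      abel

theorem IsPositiveSystem.eq_zero_of_neg_mem (hPos : IsPositiveSystem k s H Pos) {χ : Dual k H}
    (h1 : χ ∈ AddSubmonoid.closure Pos) (h2 : -χ ∈ AddSubmonoid.closure Pos) : χ = 0 := by
  obtain ⟨S, hS, rfl⟩ := AddSubmonoid.exists_multiset_of_mem_closure h1
  obtain ⟨T, hT, hTS⟩ := AddSubmonoid.exists_multiset_of_mem_closure h2
  by_contra hne
  have hcard : S.card ≠ 0 := fun h => hne (by simp [Multiset.card_eq_zero.1 h])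
  refine hPos.sum_ne_zero (S.card + T.card - 1) (S + T) (by simp; omega) ?_ ?_
  · intro α hα
    exact (Multiset.mem_add.1 hα).elim (hS α) (hT α)
  · rw [Multiset.sum_add, hTS, add_neg_cancel]

/-- The dominance order determined by a positive system. -/
def DomLT (Pos : Set (Dual k H)) (a b : Dual k H) : Prop :=
  b - a ∈ AddSubmonoid.closure Pos ∧ a ≠ b

theorem IsPositiveSystem.domLT_trans (hPos : IsPositiveSystem k s H Pos) {a b c : Dual k H}
    (h1 : DomLT Pos a b) (h2 : DomLT Pos b c) : DomLT Pos a c := by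
  refine ⟨by simpa using add_mem h2.1 h1.1, ?_⟩
  rintro rfl
  have := hPos.eq_zero_of_neg_mem h1.1 (by rw [neg_sub]; exact h2.1)
  exact h1.2 (sub_eq_zero.1 this).symm

theorem IsPositiveSystem.exists_maximal (hPos : IsPositiveSystem k s H Pos) {S : Set (Dual k H)}
    (hS : S.Finite) (hne : S.Nonempty) : ∃ a ∈ S, ∀ b ∈ S, ¬ DomLT Pos a b := by
  have : Finite S := hS
  have : IsTrans S (fun a b => DomLT Pos b.1 a.1) := ⟨fun a b c h1 h2 => hPos.domLT_trans h2 h1⟩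
  have : Std.Irrefl (fun a b : S => DomLT Pos b.1 a.1) := ⟨fun a h => h.2 rfl⟩
  obtain ⟨a, -, ha⟩ := (Finite.wellFounded_of_trans_of_irrefl
    (fun a b : S => DomLT Pos b.1 a.1)).has_min Set.univ ⟨⟨_, hne.some_mem⟩, trivial⟩
  exact ⟨a, a.2, fun b hb h => ha ⟨b, hb⟩ trivial h⟩

/-- The simple roots of a positive system. -/
def IsSimpleRoot (Pos : Set (Dual k H)) (α : Dual k H) : Prop :=
  α ∈ Pos ∧ ∀ β ∈ Pos, ∀ γ ∈ Pos, α ≠ β + γ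

theorem IsPositiveSystem.induction (hPos : IsPositiveSystem k s H Pos) {P : Dual k H → Prop}
    (h1 : ∀ α, IsSimpleRoot Pos α → P α)
    (h2 : ∀ β ∈ Pos, ∀ γ ∈ Pos, β + γ ∈ Pos → P β → P γ → P (β + γ)) {α : Dual k H}
    (hα : α ∈ Pos) : P α := by
  have : Finite Pos := finite_setOf_isRoot.subset hPos.1
  have : IsTrans Pos (fun a b => DomLT Pos a.1 b.1) := ⟨fun a b c h1 h2 => hPos.domLT_trans h1 h2⟩
  have : Std.Irrefl (fun a b : Pos => DomLT Pos a.1 b.1) := ⟨fun a h => h.2 rfl⟩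
  suffices ∀ a : Pos, P a from this ⟨α, hα⟩
  intro a
  induction a using (Finite.wellFounded_of_trans_of_irrefl
    (fun a b : Pos => DomLT Pos a.1 b.1)).induction with
  | _ a ih =>
    by_cases ha : IsSimpleRoot Pos a.1
    · exact h1 _ ha
    · simp only [IsSimpleRoot, not_and, not_forall, not_not] at ha
      obtain ⟨β, hβ, γ, hγ, hs⟩ := ha a.2
      rw [hs]
      refine h2 β hβ γ hγ (hs ▸ a.2) (ih ⟨β, hβ⟩ ⟨?_, ?_⟩) (ih ⟨γ, hγ⟩ ⟨?_, ?_⟩)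
      · simpa [hs] using AddSubmonoid.subset_closure hγ
      · simpa [hs] using (hPos.1 γ hγ).1
      · simpa [hs] using AddSubmonoid.subset_closure hβ
      · simpa [hs] using (hPos.1 β hβ).1

theorem IsPositiveSystem.mem_or_neg_mem (hPos : IsPositiveSystem k s H Pos) {α : Dual k H}
    (hα : IsRoot k s H α) : α ∈ Pos ∨ -α ∈ Pos := by
  by_cases h : -α ∈ Pos
  · exact Or.inr h
  · exact Or.inl ((hPos.2.1 α hα).2 h)

theorem IsPositiveSystem.sub_mem (hPos : IsPositiveSystem k s H Pos) {α γ : Dual k H}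
    (hα : IsSimpleRoot Pos α) (hγ : γ ∈ Pos) (h : IsRoot k s H (γ - α)) : γ - α ∈ Pos := by
  refine (hPos.mem_or_neg_mem h).resolve_right fun h' => ?_
  rw [neg_sub] at h'
  exact hα.2 _ h' _ hγ (by simp)

theorem IsPositiveSystem.not_isRoot_sub (hPos : IsPositiveSystem k s H Pos) {α β : Dual k H}
    (hα : IsSimpleRoot Pos α) (hβ : IsSimpleRoot Pos β) : ¬ IsRoot k s H (α - β) := by
  intro h
  exact hα.2 _ (hPos.sub_mem hβ hα.1 h) _ hβ.1 (by simp)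

theorem IsPositiveSystem.lieSubalgebra_eq_top (hPos : IsPositiveSystem k s H Pos)
    {S : LieSubalgebra k s} (h1 : ∀ α, IsSimpleRoot Pos α → ∀ x ∈ wtSpace k s H s α, x ∈ S)
    (h2 : ∀ α, IsSimpleRoot Pos α → ∀ x ∈ wtSpace k s H s (-α), x ∈ S) : S = ⊤ := by
  have h3 : ∀ α ∈ Pos, (∀ x ∈ wtSpace k s H s α, x ∈ S) ∧ ∀ x ∈ wtSpace k s H s (-α), x ∈ S := by
    intro α hα
    refine hPos.induction (P := fun α => (∀ x ∈ wtSpace k s H s α, x ∈ S) ∧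
      ∀ x ∈ wtSpace k s H s (-α), x ∈ S) (fun α hα => ⟨h1 α hα, h2 α hα⟩) ?_ hα
    · intro β hβ γ hγ hβγ ihβ ihγ
      have hβ' := hPos.1 β hβ
      have hγ' := hPos.1 γ hγ
      have hβγ' := hPos.1 _ hβγ
      constructor
      · intro z hz
        obtain ⟨x, hx, y, hy, rfl⟩ := exists_lie_eq_of_isRoot_add hβ' hγ' hβγ' hz
        exact S.lie_mem (ihβ.1 x hx) (ihγ.1 y hy)
      · intro z hz
        rw [neg_add] at hz
        obtain ⟨x, hx, y, hy, rfl⟩ := exists_lie_eq_of_isRoot_add hβ'.neg hγ'.neg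
          (by rw [← neg_add]; exact hβγ'.neg) hz
        exact S.lie_mem (ihβ.2 x hx) (ihγ.2 y hy)
  refine lieSubalgebra_eq_top_of_wtSpace_le (H := H) fun α hα => ?_
  rcases hPos.mem_or_neg_mem hα with h | h
  · exact (h3 α h).1
  · simpa using (h3 _ h).2

end PositiveSystem

section Modules
open LieModule Module

variable {k s H}
variable {M : Type u} [AddCommGroup M] [Module k M] [LieRingModule s M] [LieModule k s M]

theorem coe_mem_wtSpace {N : LieSubmodule k s M} {χ : Dual k H} {n : N} :
    (n : M) ∈ wtSpace k s H M χ ↔ n ∈ wtSpace k s H N χ :=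
  forall_congr' fun x => by rw [← LieSubmodule.coe_bracket, ← SetLike.val_smul, Subtype.ext_iff]

theorem map_mem_wtSpace {M' : Type u} [AddCommGroup M'] [Module k M'] [LieRingModule s M']
    [LieModule k s M'] (f : M →ₗ⁅k,s⁆ M') {χ : Dual k H} {m : M} (hm : m ∈ wtSpace k s H M χ) :
    f m ∈ wtSpace k s H M' χ := fun x => by rw [← LieModuleHom.map_lie, hm x, map_smul]

theorem isWeightOf_of_mem {χ : Dual k H} {m : M} (hm : m ∈ wtSpace k s H M χ) (h0 : m ≠ 0) :
    IsWeightOf k s H M χ := fun h => h0 (by rwa [h, Submodule.mem_bot] at hm)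

theorem IsWeightOf.exists_ne_zero {χ : Dual k H} (h : IsWeightOf k s H M χ) :
    ∃ m ∈ wtSpace k s H M χ, m ≠ 0 := Submodule.exists_mem_ne_zero_of_ne_bot h

theorem iSupIndep_wtSpace : iSupIndep (wtSpace k s H M) := by
  have h1 : iSupIndep fun χ : Dual k H => (genWeightSpace M (χ : H → k)).toSubmodule := by
    have := LieSubmodule.iSupIndep_toSubmodule.2 (iSupIndep_genWeightSpace k H M)
    exact this.comp (f := fun χ : Dual k H => (χ : H → k)) DFunLike.coe_injective
  exact h1.mono fun χ m hm => weightSpace_le_genWeightSpace M χ ((mem_weightSpace _ _).2 hm)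

variable [FiniteDimensional k M]

theorem finite_setOf_isWeightOf : {χ : Dual k H | IsWeightOf k s H M χ}.Finite :=
  WellFoundedGT.finite_ne_bot_of_iSupIndep iSupIndep_wtSpace

variable (H) in
theorem exists_isWeightOf [Nontrivial M] : ∃ χ : Dual k H, IsWeightOf k s H M χ := by
  have h := iSup_genWeightSpace_eq_top' k H M
  have : ∃ χ : Weight k H M, True := by
    by_contra! hn
    have : IsEmpty (Weight k H M) := ⟨hn⟩
    rw [iSup_of_empty] at h
    exact bot_ne_top h
  obtain ⟨χ, -⟩ := this
  obtain ⟨m, h0, hm⟩ := exists_forall_lie_eq_smul k H M χ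
  exact ⟨χ.toLinear, isWeightOf_of_mem (m := m) (fun x => hm x) h0⟩

theorem iSup_wtSpace_eq_top : ⨆ χ, wtSpace k s H M χ = ⊤ := by
  let S : LieSubalgebra k s :=
    { carrier := {x | ∀ m ∈ ⨆ χ, wtSpace k s H M χ, ⁅x, m⁆ ∈ ⨆ χ, wtSpace k s H M χ}
      add_mem' := fun hx hy m hm => by rw [add_lie]; exact add_mem (hx m hm) (hy m hm)
      zero_mem' := fun m _ => by simp
      smul_mem' := fun c x hx m hm => by rw [smul_lie]; exact Submodule.smul_mem _ c (hx m hm)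
      lie_mem' := fun hx hy m hm => by
        rw [lie_lie]; exact sub_mem (hx _ (hy m hm)) (hy _ (hx m hm)) }
  have hS : S = ⊤ := by
    refine lieSubalgebra_eq_top_of_wtSpace_le (H := H) fun α _ x hx m hm => ?_
    refine Submodule.iSup_induction (wtSpace k s H M)
      (motive := fun m => ⁅x, m⁆ ∈ ⨆ χ, wtSpace k s H M χ) hm (fun χ m hm => ?_) (by simp)
      fun m m' h h' => by rw [lie_add]; exact add_mem h h'
    exact Submodule.mem_iSup_of_mem (α + χ) (lie_mem_wtSpace hx hm)
  let N : LieSubmodule k s M :=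
    { (⨆ χ, wtSpace k s H M χ : Submodule k M) with
      lie_mem := fun {x m} hm => (hS ▸ LieSubalgebra.mem_top x : x ∈ S) m hm }
  obtain ⟨N', hN⟩ := exists_isCompl_lieSubmodule N
  have hb : N' = ⊥ := by
    by_contra hne
    have : Nontrivial N' := (LieSubmodule.nontrivial_iff_ne_bot k s M).2 hne
    obtain ⟨χ, hχ⟩ := exists_isWeightOf (M := N') H
    obtain ⟨m, hm, h0⟩ := hχ.exists_ne_zero
    have h1 : (m : M) ∈ N := Submodule.mem_iSup_of_mem χ (coe_mem_wtSpace.2 hm)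
    have h2 : (m : M) ∈ N ⊓ N' := ⟨h1, m.2⟩
    rw [hN.inf_eq_bot, LieSubmodule.mem_bot] at h2
    exact h0 (Subtype.ext h2)
  have ht : N = ⊤ := by simpa [hb] using hN.sup_eq_top
  exact congrArg LieSubmodule.toSubmodule ht

variable (H) in
theorem wtSpace_induction {P : M → Prop} (h0 : P 0) (hadd : ∀ m m', P m → P m' → P (m + m'))
    (h : ∀ (χ : Dual k H), ∀ m ∈ wtSpace k s H M χ, P m) (m : M) : P m :=
  Submodule.iSup_induction (wtSpace k s H M) (motive := P)
    ((iSup_wtSpace_eq_top (H := H) (M := M)).symm ▸ Submodule.mem_top) h h0 hadd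

end Modules

section HighestWeight
open LieModule Module

variable {k s H}
variable {Pos : Set (Dual k H)}
variable {M : Type u} [AddCommGroup M] [Module k M] [LieRingModule s M] [LieModule k s M]

variable (M Pos) in
/-- `v` is a highest weight vector of weight `κ`: a nonzero vector of weight `κ` annihilated
by all positive root vectors. -/
def IsHighestWeightVector (κ : Dual k H) (v : M) : Prop :=
  v ≠ 0 ∧ v ∈ wtSpace k s H M κ ∧ ∀ γ ∈ Pos, ∀ x ∈ wtSpace k s H s γ, ⁅x, v⁆ = 0

theorem IsPositiveSystem.isHighestWeightVector_of_simple (hPos : IsPositiveSystem k s H Pos)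
    {κ : Dual k H} {v : M} (h0 : v ≠ 0) (hv : v ∈ wtSpace k s H M κ)
    (h : ∀ α, IsSimpleRoot Pos α → ∀ x ∈ wtSpace k s H s α, ⁅x, v⁆ = 0) :
    IsHighestWeightVector Pos M κ v := by
  refine ⟨h0, hv, fun γ hγ => hPos.induction
    (P := fun γ => ∀ x ∈ wtSpace k s H s γ, ⁅x, v⁆ = 0) h ?_ hγ⟩
  intro β hβ γ hγ hβγ h1 h2 z hz
  obtain ⟨x, hx, y, hy, rfl⟩ :=
    exists_lie_eq_of_isRoot_add (hPos.1 β hβ) (hPos.1 γ hγ) (hPos.1 _ hβγ) hz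
  rw [lie_lie, h1 x hx, h2 y hy, lie_zero, lie_zero, sub_zero]

theorem IsHighestWeightVector.of_maximal (hPos : IsPositiveSystem k s H Pos) {κ : Dual k H}
    (h : ∀ χ, IsWeightOf k s H M χ → ¬ DomLT Pos κ χ) {v : M} (h0 : v ≠ 0)
    (hv : v ∈ wtSpace k s H M κ) : IsHighestWeightVector Pos M κ v := by
  refine ⟨h0, hv, fun γ hγ x hx => ?_⟩
  by_contra hne
  refine h _ (isWeightOf_of_mem (lie_mem_wtSpace hx hv) hne) ⟨?_, ?_⟩
  · simpa using AddSubmonoid.subset_closure hγ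
  · simpa using (hPos.1 γ hγ).1

theorem IsHighestWeightOf.isHighestWeightVector (hPos : IsPositiveSystem k s H Pos)
    {κ : Dual k H} (h : IsHighestWeightOf k s H Pos M κ) {v : M} (h0 : v ≠ 0)
    (hv : v ∈ wtSpace k s H M κ) : IsHighestWeightVector Pos M κ v := by
  refine .of_maximal hPos (fun χ hχ hlt => hlt.2 ?_) h0 hv
  have := hPos.eq_zero_of_neg_mem hlt.1 (by rw [neg_sub]; exact h.2 χ hχ)
  exact (sub_eq_zero.1 this).symm

theorem IsHighestWeightVector.map {M' : Type u} [AddCommGroup M'] [Module k M']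
    [LieRingModule s M'] [LieModule k s M'] (f : M →ₗ⁅k,s⁆ M') {κ : Dual k H} {v : M}
    (h : IsHighestWeightVector Pos M κ v) (h0 : f v ≠ 0) :
    IsHighestWeightVector Pos M' κ (f v) :=
  ⟨h0, map_mem_wtSpace f h.2.1, fun γ hγ x hx => by
    rw [← LieModuleHom.map_lie, h.2.2 γ hγ x hx, map_zero]⟩

theorem isHighestWeightVector_coe {N : LieSubmodule k s M} {κ : Dual k H} {v : N} :
    IsHighestWeightVector Pos M κ (v : M) ↔ IsHighestWeightVector Pos N κ v := by
  refine and_congr (by simp) (and_congr coe_mem_wtSpace ?_)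
  refine forall₄_congr fun γ _ x _ => ?_
  rw [← LieSubmodule.coe_bracket, ZeroMemClass.coe_eq_zero]

theorem IsPositiveSystem.exists_isHighestWeightVector_of_isWeightOf [FiniteDimensional k M]
    (hPos : IsPositiveSystem k s H Pos) {χ : Dual k H} (hχ : IsWeightOf k s H M χ) :
    ∃ κ v, IsHighestWeightVector Pos M κ v ∧ κ - χ ∈ AddSubmonoid.closure Pos := by
  obtain ⟨κ, ⟨hκ, hκχ⟩, hmax⟩ := hPos.exists_maximal
    (S := {κ | IsWeightOf k s H M κ ∧ κ - χ ∈ AddSubmonoid.closure Pos})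
    (finite_setOf_isWeightOf.subset fun κ h => h.1) ⟨χ, hχ, by simp⟩
  obtain ⟨v, hv, h0⟩ := hκ.exists_ne_zero
  refine ⟨κ, v, .of_maximal hPos (fun χ' h' hlt => hmax χ' ⟨h', ?_⟩ hlt) h0 hv, hκχ⟩
  simpa using add_mem hlt.1 hκχ

theorem IsPositiveSystem.exists_isHighestWeightVector [FiniteDimensional k M] [Nontrivial M]
    (hPos : IsPositiveSystem k s H Pos) : ∃ κ v, IsHighestWeightVector Pos M κ v := by
  obtain ⟨χ, hχ⟩ := exists_isWeightOf (M := M) H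
  obtain ⟨κ, v, h, -⟩ := hPos.exists_isHighestWeightVector_of_isWeightOf hχ
  exact ⟨κ, v, h⟩

theorem IsHighestWeightVector.lieSpan_le (hPos : IsPositiveSystem k s H Pos) {κ : Dual k H} {v : M}
    (h : IsHighestWeightVector Pos M κ v) {C : Submodule k M} (hv : v ∈ C)
    (hC : ∀ α ∈ Pos, ∀ x ∈ wtSpace k s H s (-α), ∀ m ∈ C, ⁅x, m⁆ ∈ C) :
    (LieSubmodule.lieSpan k s {v}).toSubmodule ≤ C := by
  let W : Submodule k M := sInf {C | v ∈ C ∧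
    ∀ α ∈ Pos, ∀ x ∈ wtSpace k s H s (-α), ∀ m ∈ C, ⁅x, m⁆ ∈ C}
  have hvW : v ∈ W := (Submodule.mem_sInf).2 fun C hC => hC.1
  have hW : ∀ α ∈ Pos, ∀ x ∈ wtSpace k s H s (-α), ∀ m ∈ W, ⁅x, m⁆ ∈ W :=
    fun α hα x hx m hm => (Submodule.mem_sInf).2 fun C hC =>
      hC.2 α hα x hx m ((Submodule.mem_sInf).1 hm C hC)
  have hWC : W ≤ C := sInf_le ⟨hv, hC⟩
  let W' : Submodule k M :=
    { carrier := {m | m ∈ W ∧ ∀ x : s, ⁅x, m⁆ ∈ W}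
      add_mem' := fun ha hb => ⟨add_mem ha.1 hb.1, fun x => by
        rw [lie_add]; exact add_mem (ha.2 x) (hb.2 x)⟩
      zero_mem' := ⟨zero_mem _, fun x => by simp⟩
      smul_mem' := fun c m hm => ⟨Submodule.smul_mem _ c hm.1, fun x => by
        rw [lie_smul]; exact Submodule.smul_mem _ c (hm.2 x)⟩ }
  have hWW' : W ≤ W' := by
    refine sInf_le ⟨⟨hvW, fun x => ?_⟩, fun α hα x hx m hm => ⟨hW α hα x hx m hm.1, fun y => ?_⟩⟩
    · refine wtSpace_induction H (P := fun x : s => ⁅x, v⁆ ∈ W) (by simp)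
        (fun x y hx hy => by rw [add_lie]; exact add_mem hx hy) (fun χ x hx => ?_) x
      by_cases hx0 : x = 0
      · simp [hx0]
      by_cases hχ0 : χ = 0
      · have : x ∈ H := by
          rw [hχ0, mem_wtSpace_iff_mem_rootSpace] at hx
          rwa [← LieAlgebra.zeroRootSubalgebra_eq_of_is_cartan k s H]
        have := h.2.1 ⟨x, this⟩
        simp only at this
        rw [this]
        exact Submodule.smul_mem _ _ hvW
      · rcases hPos.mem_or_neg_mem ⟨hχ0, isWeightOf_of_mem hx hx0⟩ with hp | hn
        · rw [h.2.2 χ hp x hx]; exact zero_mem _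
        · exact hW _ hn x (by simpa using hx) v hvW
    · rw [leibniz_lie y x m]
      exact add_mem (hm.2 _) (hW α hα x hx _ (hm.2 y))
  let N : LieSubmodule k s M := { W with lie_mem := fun {x m} hm => (hWW' hm).2 x }
  have : LieSubmodule.lieSpan k s {v} ≤ N :=
    LieSubmodule.lieSpan_le.2 (Set.singleton_subset_iff.2 hvW)
  exact le_trans this hWC

theorem IsHighestWeightVector.exists_eq_smul_add (hPos : IsPositiveSystem k s H Pos)
    {κ : Dual k H} {v : M} (h : IsHighestWeightVector Pos M κ v)
    (htop : LieSubmodule.lieSpan k s {v} = ⊤) (m : M) :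
    ∃ (c : k), ∃ m' ∈ ⨆ χ, ⨆ _ : DomLT Pos χ κ, wtSpace k s H M χ, c • v + m' = m := by
  set C := ⨆ χ, ⨆ _ : DomLT Pos χ κ, wtSpace k s H M χ with hCdef
  have hlow : ∀ α ∈ Pos, ∀ x ∈ wtSpace k s H s (-α), ∀ χ, (χ = κ ∨ DomLT Pos χ κ) →
      ∀ m ∈ wtSpace k s H M χ, ⁅x, m⁆ ∈ C := by
    intro α hα x hx χ hχ m hm
    have h1 : DomLT Pos (-α + χ) χ := ⟨by simpa using AddSubmonoid.subset_closure hα,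
      by simpa using (hPos.1 α hα).1⟩
    have h2 : DomLT Pos (-α + χ) κ := by
      rcases hχ with rfl | hχ
      · exact h1
      · exact hPos.domLT_trans h1 hχ
    exact Submodule.mem_iSup_of_mem _ (Submodule.mem_iSup_of_mem h2 (lie_mem_wtSpace hx hm))
  have key := h.lieSpan_le hPos (C := k ∙ v ⊔ C)
    (Submodule.mem_sup_left (Submodule.mem_span_singleton_self v)) fun α hα x hx m hm => by
      obtain ⟨y, hy, m', hm', rfl⟩ := Submodule.mem_sup.1 hm
      obtain ⟨c, rfl⟩ := Submodule.mem_span_singleton.1 hy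
      rw [lie_add, lie_smul]
      refine Submodule.mem_sup_right (add_mem (Submodule.smul_mem _ c ?_) ?_)
      · exact hlow α hα x hx κ (Or.inl rfl) v h.2.1
      · have h1 : C ≤ C.comap (toEnd k s M x) :=
          iSup₂_le fun χ hχ m hm => hlow α hα x hx χ (Or.inr hχ) m hm
        exact h1 hm'
  rw [htop] at key
  obtain ⟨y, hy, m', hm', rfl⟩ := Submodule.mem_sup.1 (key (Submodule.mem_top (x := m)))
  obtain ⟨c, rfl⟩ := Submodule.mem_span_singleton.1 hy
  exact ⟨c, m', hm', rfl⟩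

theorem IsHighestWeightVector.exists_smul_eq (hPos : IsPositiveSystem k s H Pos)
    {κ : Dual k H} {v : M} (h : IsHighestWeightVector Pos M κ v)
    (htop : LieSubmodule.lieSpan k s {v} = ⊤) {m : M} (hm : m ∈ wtSpace k s H M κ) :
    ∃ c : k, c • v = m := by
  obtain ⟨c, m', hm', rfl⟩ := h.exists_eq_smul_add hPos htop m
  refine ⟨c, ?_⟩
  have h1 : m' ∈ wtSpace k s H M κ := by
    simpa using sub_mem hm (Submodule.smul_mem _ c h.2.1)
  have h2 : m' ∈ ⨆ χ, ⨆ _ : χ ≠ κ, wtSpace k s H M χ :=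
    (iSup_mono fun χ => iSup_const_mono fun h : DomLT Pos χ κ => h.2 :
      (⨆ χ, ⨆ _ : DomLT Pos χ κ, wtSpace k s H M χ) ≤ _) hm'
  rw [Submodule.disjoint_def.1 (iSupIndep_wtSpace κ) m' h1 h2, add_zero]

theorem IsHighestWeightVector.isHighestWeightOf (hPos : IsPositiveSystem k s H Pos)
    {κ : Dual k H} {v : M} (h : IsHighestWeightVector Pos M κ v)
    (htop : LieSubmodule.lieSpan k s {v} = ⊤) : IsHighestWeightOf k s H Pos M κ := by
  refine ⟨isWeightOf_of_mem h.2.1 h.1, fun χ hχ => ?_⟩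
  by_contra hne
  obtain ⟨m, hm, h0⟩ := hχ.exists_ne_zero
  refine h0 (Submodule.disjoint_def.1 (iSupIndep_wtSpace χ) m hm ?_)
  obtain ⟨c, m', hm', rfl⟩ := h.exists_eq_smul_add hPos htop m
  refine add_mem (Submodule.smul_mem _ c ?_) ?_
  · refine Submodule.mem_iSup_of_mem κ (Submodule.mem_iSup_of_mem ?_ h.2.1)
    rintro rfl
    exact hne (by simp)
  · refine (iSup_mono fun ψ => iSup_const_mono fun h : DomLT Pos ψ κ => ?_ :
      (⨆ ψ, ⨆ _ : DomLT Pos ψ κ, wtSpace k s H M ψ) ≤ _) hm'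
    rintro rfl
    exact hne h.1

theorem IsHighestWeightVector.isIrreducible [FiniteDimensional k M]
    (hPos : IsPositiveSystem k s H Pos)
    {κ : Dual k H} {v : M} (h : IsHighestWeightVector Pos M κ v)
    (htop : LieSubmodule.lieSpan k s {v} = ⊤) : LieModule.IsIrreducible k s M := by
  have : Nontrivial M := ⟨v, 0, h.1⟩
  refine LieModule.IsIrreducible.mk fun N hN => ?_
  obtain ⟨N', hc⟩ := exists_isCompl_lieSubmodule N
  have hv : v ∈ N ⊔ N' := by rw [hc.sup_eq_top]; trivial
  obtain ⟨p, hp⟩ := exists_projection N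
  obtain ⟨c, hcv⟩ := h.exists_smul_eq hPos htop
    (coe_mem_wtSpace.2 (map_mem_wtSpace p h.2.1))
  have hle : ∀ N : LieSubmodule k s M, v ∈ N → N = ⊤ := fun N hN => by
    rw [eq_top_iff, ← htop]
    exact LieSubmodule.lieSpan_le.2 (Set.singleton_subset_iff.2 hN)
  by_cases h0 : c = 0
  · exfalso
    have hpv : p v = 0 := by rw [h0, zero_smul] at hcv; exact Subtype.ext hcv.symm
    have hk : p.ker = ⊤ := hle _ ((LieModuleHom.mem_ker).2 hpv)
    refine hN ((LieSubmodule.eq_bot_iff _).2 fun n hn => ?_)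
    have : n ∈ p.ker := by rw [hk]; trivial
    rw [LieModuleHom.mem_ker, hp ⟨n, hn⟩] at this
    exact congrArg Subtype.val this
  · refine hle N ?_
    have : c⁻¹ • (p v : M) = v := by rw [← hcv, smul_smul, inv_mul_cancel₀ h0, one_smul]
    rw [← this]
    exact N.smul_mem _ (p v).2

theorem lieSpan_singleton_eq_top_of_isIrreducible [LieModule.IsIrreducible k s M] {v : M}
    (h0 : v ≠ 0) : LieSubmodule.lieSpan k s {v} = ⊤ := by
  refine (eq_bot_or_eq_top _).resolve_left fun h => h0 ?_
  have : v ∈ LieSubmodule.lieSpan k s {v} := LieSubmodule.subset_lieSpan rfl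
  rwa [h, LieSubmodule.mem_bot] at this

theorem lieSpan_singleton_coe_eq_top {N : LieSubmodule k s M} {v : N}
    (hN : N = LieSubmodule.lieSpan k s {(v : M)}) : LieSubmodule.lieSpan k s {v} = ⊤ := by
  have h : N ≤ (LieSubmodule.lieSpan k s {v}).map N.incl := by
    conv_lhs => rw [hN]
    exact LieSubmodule.lieSpan_le.2 (Set.singleton_subset_iff.2
      (LieSubmodule.mem_map_of_mem (f := N.incl) (LieSubmodule.subset_lieSpan rfl)))
  rw [eq_top_iff]
  rintro n -
  obtain ⟨n', hn', hnn⟩ := (LieSubmodule.mem_map _).1 (h n.2)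
  rwa [← show n' = n from Subtype.ext hnn]

variable (M Pos) in
/-- `M` is an irreducible finite-dimensional module of highest weight `κ`. -/
def IsIrreducibleOfHighestWeight (κ : Dual k H) : Prop :=
  LieModule.IsIrreducible k s M ∧ FiniteDimensional k M ∧ IsHighestWeightOf k s H Pos M κ

theorem IsHighestWeightVector.isIrreducibleOfHighestWeight_lieSpan [FiniteDimensional k M]
    (hPos : IsPositiveSystem k s H Pos)
    {κ : Dual k H} {v : M} (h : IsHighestWeightVector Pos M κ v) :
    IsIrreducibleOfHighestWeight Pos (LieSubmodule.lieSpan k s {v}) κ := by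
  have hv : v ∈ LieSubmodule.lieSpan k s {v} := LieSubmodule.subset_lieSpan rfl
  have h1 : IsHighestWeightVector Pos (LieSubmodule.lieSpan k s {v}) κ ⟨v, hv⟩ :=
    isHighestWeightVector_coe.1 h
  have h2 := lieSpan_singleton_coe_eq_top (v := ⟨v, hv⟩) rfl
  exact ⟨h1.isIrreducible hPos h2, inferInstance, h1.isHighestWeightOf hPos h2⟩

end HighestWeight

section Homomorphisms
open LieModule Module

section General

variable {K L : Type*} [Field K] [LieRing L] [LieAlgebra K L]
variable {V W M N P : Type*} [AddCommGroup V] [Module K V] [LieRingModule L V] [LieModule K L V]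
  [AddCommGroup W] [Module K W] [LieRingModule L W] [LieModule K L W]
  [AddCommGroup M] [Module K M] [LieRingModule L M] [LieModule K L M]
  [AddCommGroup N] [Module K N] [LieRingModule L N] [LieModule K L N]
  [AddCommGroup P] [Module K P] [LieRingModule L P] [LieModule K L P]

theorem LieModuleHom.injective_of_isIrreducible [LieModule.IsIrreducible K L M]
    {f : M →ₗ⁅K,L⁆ N} (hf : f ≠ 0) : Function.Injective f := by
  refine (injective_iff_map_eq_zero f).2 fun m hm => ?_
  have h : f.ker = ⊥ := (eq_bot_or_eq_top f.ker).resolve_right fun h => hf <| by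
    ext m
    exact (LieModuleHom.mem_ker (f := f)).1 (by rw [h]; trivial)
  have : m ∈ f.ker := (LieModuleHom.mem_ker).2 hm
  rwa [h, LieSubmodule.mem_bot] at this

theorem LieModuleHom.surjective_of_isIrreducible [LieModule.IsIrreducible K L N]
    {f : M →ₗ⁅K,L⁆ N} (hf : f ≠ 0) : Function.Surjective f := by
  have h : f.range = ⊤ := (eq_bot_or_eq_top f.range).resolve_left fun h => hf <| by
    ext m
    have : f m ∈ f.range := (LieModuleHom.mem_range f _).2 ⟨m, rfl⟩
    rwa [h, LieSubmodule.mem_bot] at this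
  intro n
  exact (LieModuleHom.mem_range f n).1 (by rw [h]; trivial)

theorem LieModuleHom.comp_ne_zero_of_surjective {f : M →ₗ⁅K,L⁆ N} {g : N →ₗ⁅K,L⁆ P}
    (hf : Function.Surjective f) (hg : g ≠ 0) : g.comp f ≠ 0 := by
  intro h
  refine hg (LieModuleHom.ext fun n => ?_)
  obtain ⟨m, rfl⟩ := hf n
  exact LieModuleHom.congr_fun h m

theorem LieModuleHom.exists_section [LieAlgebra.IsSemisimple K L] [CharZero K]
    [FiniteDimensional K L] [FiniteDimensional K M]
    {f : M →ₗ⁅K,L⁆ N} (hf : Function.Surjective f) : ∃ g : N →ₗ⁅K,L⁆ M, ∀ n, f (g n) = n := by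
  obtain ⟨p, hp⟩ := exists_projection f.ker
  have key : ∀ a b, f a = f b → a - p a = b - p b := by
    intro a b hab
    have h1 : a - b ∈ f.ker := (LieModuleHom.mem_ker).2 (by rw [map_sub, hab, sub_self])
    have h2 := congrArg Subtype.val (hp ⟨a - b, h1⟩)
    simp only [map_sub, LieSubmodule.coe_sub] at h2
    rw [sub_eq_sub_iff_sub_eq_sub, h2]
  choose r hr using hf
  have hk : ∀ a, f (p a : M) = 0 := fun a => (LieModuleHom.mem_ker).1 (p a).2
  refine ⟨{
    toFun := fun n => r n - (p (r n) : M)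
    map_add' := fun a b => ?_
    map_smul' := fun c a => ?_
    map_lie' := @fun x a => ?_ }, fun n => ?_⟩
  · rw [key _ (r a + r b) (by rw [map_add, hr, hr, hr]), map_add, LieSubmodule.coe_add]
    abel
  · rw [key _ (c • r a) (by rw [map_smul, hr, hr]), map_smul, LieSubmodule.coe_smul, smul_sub]
    rfl
  · rw [key _ ⁅x, r a⁆ (by rw [LieModuleHom.map_lie, hr, hr]), LieModuleHom.map_lie,
      LieSubmodule.coe_bracket, lie_sub]
  · change f (r n - p (r n)) = n
    rw [map_sub, hk, sub_zero, hr]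

/-- A linear map on a tensor product of Lie modules that is equivariant on pure tensors is
equivariant. -/
def LieModuleHom.ofTmul (φ : V ⊗[K] W →ₗ[K] M)
    (h : ∀ (x : L) v w, φ (⁅x, v⁆ ⊗ₜ w) + φ (v ⊗ₜ ⁅x, w⁆) = ⁅x, φ (v ⊗ₜ w)⁆) :
    V ⊗[K] W →ₗ⁅K,L⁆ M :=
  { φ with
    map_lie' := fun {x t} => by
      change φ ⁅x, t⁆ = ⁅x, φ t⁆
      induction t with
      | zero => simp
      | tmul v w => rw [TensorProduct.LieModule.lie_tmul_right, map_add, h]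
      | add a b ha hb => rw [lie_add, map_add, map_add, lie_add, ha, hb] }

variable (K L V W M) in
/-- The associator of the tensor product of Lie modules. -/
def lieTensorAssocSymm : V ⊗[K] (W ⊗[K] M) →ₗ⁅K,L⁆ (V ⊗[K] W) ⊗[K] M :=
  LieModuleHom.ofTmul (TensorProduct.assoc K V W M).symm.toLinearMap fun x v t => by
    induction t with
    | zero => simp
    | tmul w m =>
      simp [TensorProduct.LieModule.lie_tmul_right, TensorProduct.tmul_add,
        TensorProduct.add_tmul, add_assoc]
    | add a b ha hb =>
      simp only [TensorProduct.tmul_add, lie_add, map_add] at ha hb ⊢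
      rw [← ha, ← hb]
      abel

theorem lieTensorAssocSymm_surjective :
    Function.Surjective (lieTensorAssocSymm K L V W M) :=
  (TensorProduct.assoc K V W M).symm.surjective

theorem LieModuleHom.exists_tmul_ne_zero {f : V ⊗[K] M →ₗ⁅K,L⁆ N} (hf : f ≠ 0) :
    ∃ v m, f (v ⊗ₜ m) ≠ 0 := by
  by_contra! h
  refine hf (LieModuleHom.ext fun t => ?_)
  induction t with
  | zero => simp
  | tmul v m => exact h v m
  | add a b ha hb => rw [map_add, ha, hb]; simp

instance : LieRingModule L (M × N) where
  bracket x m := (⁅x, m.1⁆, ⁅x, m.2⁆)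
  add_lie _ _ _ := Prod.ext (add_lie _ _ _) (add_lie _ _ _)
  lie_add _ _ _ := Prod.ext (lie_add _ _ _) (lie_add _ _ _)
  leibniz_lie _ _ _ := Prod.ext (leibniz_lie _ _ _) (leibniz_lie _ _ _)

instance : LieModule K L (M × N) where
  smul_lie _ _ _ := Prod.ext (smul_lie _ _ _) (smul_lie _ _ _)
  lie_smul _ _ _ := Prod.ext (lie_smul _ _ _) (lie_smul _ _ _)

end General

end Homomorphisms

section Reachability
open LieModule Module

variable {k s H}
variable {Pos : Set (Dual k H)}
variable {X Y : Type u} [AddCommGroup X] [Module k X] [LieRingModule s X] [LieModule k s X]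
  [AddCommGroup Y] [Module k Y] [LieRingModule s Y] [LieModule k s Y]

theorem IsIrreducibleOfHighestWeight.exists_isHighestWeightVector
    (hPos : IsPositiveSystem k s H Pos) {κ : Dual k H} (h : IsIrreducibleOfHighestWeight Pos X κ) :
    ∃ v, IsHighestWeightVector Pos X κ v := by
  obtain ⟨v, hv, h0⟩ := h.2.2.1.exists_ne_zero
  exact ⟨v, h.2.2.isHighestWeightVector hPos h0 hv⟩

theorem IsHighestWeightOf.unique (hPos : IsPositiveSystem k s H Pos) {κ κ' : Dual k H}
    (h : IsHighestWeightOf k s H Pos X κ) (h' : IsHighestWeightOf k s H Pos X κ') : κ = κ' :=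
  sub_eq_zero.1 (hPos.eq_zero_of_neg_mem (h.2 κ' h'.1) (by rw [neg_sub]; exact h'.2 κ h.1))

theorem IsIrreducibleOfHighestWeight.eq_of_hom (hPos : IsPositiveSystem k s H Pos) {κ κ' : Dual k H}
    (hX : IsIrreducibleOfHighestWeight Pos X κ) (hY : IsIrreducibleOfHighestWeight Pos Y κ')
    {f : X →ₗ⁅k,s⁆ Y} (hf : f ≠ 0) : κ = κ' := by
  have := hX.1
  have := hY.1
  obtain ⟨v, hv⟩ := hX.exists_isHighestWeightVector hPos
  have h0 : f v ≠ 0 := fun h => hv.1 (f.injective_of_isIrreducible hf (by rw [h, map_zero]))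
  exact ((hv.map f h0).isHighestWeightOf hPos (lieSpan_singleton_eq_top_of_isIrreducible h0)).unique
    hPos hY.2.2

theorem IsIrreducibleOfHighestWeight.exists_hom (hPos : IsPositiveSystem k s H Pos) {κ : Dual k H}
    (hX : IsIrreducibleOfHighestWeight Pos X κ) (hY : IsIrreducibleOfHighestWeight Pos Y κ) :
    ∃ f : X →ₗ⁅k,s⁆ Y, Function.Surjective f := by
  have := hX.1
  have := hX.2.1
  have := hY.1
  have := hY.2.1
  obtain ⟨v, hv⟩ := hX.exists_isHighestWeightVector hPos
  obtain ⟨w, hw⟩ := hY.exists_isHighestWeightVector hPos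
  let p : X × Y →ₗ⁅k,s⁆ X := { LinearMap.fst k X Y with map_lie' := rfl }
  let q : X × Y →ₗ⁅k,s⁆ Y := { LinearMap.snd k X Y with map_lie' := rfl }
  have hvw : IsHighestWeightVector Pos (X × Y) κ (v, w) :=
    ⟨fun h => hv.1 (congrArg Prod.fst h), fun x => Prod.ext (hv.2.1 x) (hw.2.1 x),
      fun γ hγ x hx => Prod.ext (hv.2.2 γ hγ x hx) (hw.2.2 γ hγ x hx)⟩
  have hZ := hvw.isIrreducibleOfHighestWeight_lieSpan hPos
  have hmem : (v, w) ∈ LieSubmodule.lieSpan k s {(v, w)} := LieSubmodule.subset_lieSpan rfl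
  set Z := LieSubmodule.lieSpan k s {(v, w)}
  have := hZ.1
  have hp : p.comp Z.incl ≠ 0 := fun h => hv.1 (LieModuleHom.congr_fun h ⟨_, hmem⟩)
  have hq : q.comp Z.incl ≠ 0 := fun h => hw.1 (LieModuleHom.congr_fun h ⟨_, hmem⟩)
  obtain ⟨g, hg⟩ := LieModuleHom.exists_section (LieModuleHom.surjective_of_isIrreducible hp)
  refine ⟨(q.comp Z.incl).comp g, LieModuleHom.surjective_of_isIrreducible fun h => ?_⟩
  refine hv.1 ?_
  rw [← hg v, (LieModuleHom.injective_of_isIrreducible hq (a₁ := g v) (a₂ := 0)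
    (by rw [map_zero]; exact LieModuleHom.congr_fun h v)), map_zero]

variable (U : Type u) [AddCommGroup U] [Module k U] [LieRingModule s U] [LieModule k s U]

variable (Pos) in
/-- `κ'` is the highest weight of an irreducible quotient of `U ⊗ X`, where `X` is irreducible of
highest weight `κ`. -/
def HasTensorStep (κ κ' : Dual k H) : Prop :=
  ∃ X Y : LieModuleBundle k s, IsIrreducibleOfHighestWeight Pos X.carrier κ ∧
    IsIrreducibleOfHighestWeight Pos Y.carrier κ' ∧
    ∃ f : U ⊗[k] X.carrier →ₗ⁅k,s⁆ Y.carrier, f ≠ 0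

variable {U} in
theorem HasTensorStep.exists_hom (hPos : IsPositiveSystem k s H Pos) {κ κ' : Dual k H}
    (h : HasTensorStep Pos U κ κ') (hX : IsIrreducibleOfHighestWeight Pos X κ)
    (hY : IsIrreducibleOfHighestWeight Pos Y κ') :
    ∃ f : U ⊗[k] X →ₗ⁅k,s⁆ Y, f ≠ 0 := by
  obtain ⟨X', Y', hX', hY', f, hf⟩ := h
  obtain ⟨g, hg⟩ := hX.exists_hom hPos hX'
  obtain ⟨g', hg'⟩ := hY'.exists_hom hPos hY
  have := hY'.1
  have := hY.1
  have hg'0 : g' ≠ 0 := by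
    rintro rfl
    have := LieModule.nontrivial_of_isIrreducible k s Y
    obtain ⟨y, hy⟩ := exists_ne (0 : Y)
    obtain ⟨z, hz⟩ := hg' y
    exact hy hz.symm
  refine ⟨(g'.comp f).comp (TensorProduct.LieModule.map LieModuleHom.id g),
    LieModuleHom.comp_ne_zero_of_surjective ?_ (LieModuleHom.comp_ne_zero_of_surjective
      (LieModuleHom.surjective_of_isIrreducible hf) hg'0)⟩
  exact TensorProduct.map_surjective (g := LinearMap.id) Function.surjective_id hg

variable (Pos) in
/-- Tensoring with `V` leads only to irreducible constituents that are reachable by repeatedly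
tensoring with `U`. -/
def IsGood (V : Type u) [AddCommGroup V] [Module k V] [LieRingModule s V] [LieModule k s V] :
    Prop :=
  ∀ (X Y : LieModuleBundle k s) (κ κ' : Dual k H),
    IsIrreducibleOfHighestWeight Pos X.carrier κ → IsIrreducibleOfHighestWeight Pos Y.carrier κ' →
    (∃ f : V ⊗[k] X.carrier →ₗ⁅k,s⁆ Y.carrier, f ≠ 0) →
      Relation.ReflTransGen (HasTensorStep Pos U) κ κ'

theorem isGood_self : IsGood Pos U U := fun X Y _ _ hX hY h => .single ⟨X, Y, hX, hY, h⟩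

theorem isGood_trivial (hPos : IsPositiveSystem k s H Pos) :
    IsGood Pos U (TrivialLieModule k s k) := by
  rintro X Y κ κ' hX hY ⟨f, hf⟩
  obtain ⟨c, x, h⟩ := LieModuleHom.exists_tmul_ne_zero hf
  let g : X.carrier →ₗ⁅k,s⁆ Y.carrier :=
    { toFun x := f (c ⊗ₜ x)
      map_add' a b := by rw [TensorProduct.tmul_add, map_add]
      map_smul' a b := by rw [TensorProduct.tmul_smul, map_smul]; rfl
      map_lie' := @fun y a => by
        rw [← LieModuleHom.map_lie, TensorProduct.LieModule.lie_tmul_right, trivial_lie_zero s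
          (TrivialLieModule k s k) y c, TensorProduct.zero_tmul, zero_add] }
  rw [hX.eq_of_hom hPos hY (f := g) fun h0 => h (LieModuleHom.congr_fun h0 x)]

theorem exists_irreducible_tmul_ne_zero {V M N : Type u}
    [AddCommGroup V] [Module k V] [LieRingModule s V] [LieModule k s V]
    [AddCommGroup M] [Module k M] [LieRingModule s M] [LieModule k s M] [FiniteDimensional k M]
    [AddCommGroup N] [Module k N] [LieRingModule s N] [LieModule k s N]
    (hPos : IsPositiveSystem k s H Pos)
    {f : V ⊗[k] M →ₗ⁅k,s⁆ N} (hf : f ≠ 0) :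
    ∃ (Z : LieSubmodule k s M) (κ : Dual k H), IsIrreducibleOfHighestWeight Pos Z κ ∧
      f.comp (TensorProduct.LieModule.map LieModuleHom.id Z.incl) ≠ 0 := by
  let A : LieSubmodule k s M :=
    { carrier := {m | ∀ v, f (v ⊗ₜ m) = 0}
      add_mem' := fun ha hb v => by rw [TensorProduct.tmul_add, map_add, ha v, hb v, add_zero]
      zero_mem' := fun v => by simp
      smul_mem' := fun c m hm v => by rw [TensorProduct.tmul_smul, map_smul, hm v, smul_zero]
      lie_mem := fun {x m} hm v => by
        have h1 := hm ⁅x, v⁆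
        have h2 := congrArg (fun n => ⁅x, n⁆) (hm v)
        simp only [← LieModuleHom.map_lie, TensorProduct.LieModule.lie_tmul_right, map_add,
          lie_zero] at h2
        rwa [h1, zero_add] at h2 }
  obtain ⟨B, hB⟩ := exists_isCompl_lieSubmodule A
  have hB0 : B ≠ ⊥ := by
    rintro rfl
    have hA : A = ⊤ := by simpa using hB.sup_eq_top
    obtain ⟨v, m, hvm⟩ := LieModuleHom.exists_tmul_ne_zero hf
    have : m ∈ A := by rw [hA]; trivial
    exact hvm (this v)
  have : Nontrivial B := (LieSubmodule.nontrivial_iff_ne_bot k s M).2 hB0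
  obtain ⟨κ, v, hv⟩ := hPos.exists_isHighestWeightVector (M := B)
  refine ⟨_, κ, (isHighestWeightVector_coe.2 hv).isIrreducibleOfHighestWeight_lieSpan hPos,
    fun h => ?_⟩
  have hmem : (v : M) ∈ LieSubmodule.lieSpan k s {(v : M)} := LieSubmodule.subset_lieSpan rfl
  have h1 : (v : M) ∈ A ⊓ B := ⟨fun w => LieModuleHom.congr_fun h (w ⊗ₜ ⟨v, hmem⟩), v.2⟩
  rw [hB.inf_eq_bot, LieSubmodule.mem_bot] at h1
  exact hv.1 (Subtype.ext h1)

theorem IsGood.tensorProduct (hPos : IsPositiveSystem k s H Pos) {V W : Type u}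
    [AddCommGroup V] [Module k V] [LieRingModule s V] [LieModule k s V]
    [AddCommGroup W] [Module k W] [LieRingModule s W] [LieModule k s W] [FiniteDimensional k W]
    (hV : IsGood Pos U V) (hW : IsGood Pos U W) : IsGood Pos U (V ⊗[k] W) := by
  rintro X Y κ κ' hX hY ⟨f, hf⟩
  have := hX.2.1
  obtain ⟨Z, ψ, hZ, hfZ⟩ := exists_irreducible_tmul_ne_zero hPos
    (LieModuleHom.comp_ne_zero_of_surjective (lieTensorAssocSymm_surjective (K := k)) hf)
  obtain ⟨p, hp⟩ := exists_projection Z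
  have h1 := hW X ⟨Z⟩ κ ψ hX hZ ⟨p, fun h0 => ?_⟩
  · exact h1.trans (hV ⟨Z⟩ Y ψ κ' hZ hY ⟨_, hfZ⟩)
  · obtain ⟨v, hv⟩ := hZ.exists_isHighestWeightVector hPos
    exact hv.1 (by rw [← hp v, h0]; rfl)

end Reachability

section Determinant
open LieModule Module Function

theorem AlternatingMap.update_basis {K V ι : Type*} [Field K] [AddCommGroup V]
    [Module K V] [Fintype ι] [DecidableEq ι] (b : Basis ι K V) (ω : V [⋀^ι]→ₗ[K] K)
    (i : ι) (u : V) : ω (update b i u) = b.repr u i • ω b := by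
  conv_lhs => rw [← b.sum_repr u]
  rw [ω.map_update_sum, Finset.sum_eq_single i]
  · rw [ω.map_update_smul, update_eq_self]
  · intro j _ hj
    rw [ω.map_update_smul, ω.map_eq_zero_of_eq (i := i) (j := j) _ (by simp [hj]) hj.symm,
      smul_zero]
  · simp

theorem AlternatingMap.sum_update_eq_trace_smul {K V ι : Type*} [Field K] [AddCommGroup V]
    [Module K V] [Fintype ι] [DecidableEq ι] (b : Basis ι K V) (ω : V [⋀^ι]→ₗ[K] K)
    (x : V →ₗ[K] V) (v : ι → V) :
    ∑ i, ω (update v i (x (v i))) = LinearMap.trace K V x • ω v := by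
  let g : MultilinearMap K (fun _ : ι => V) K :=
    ∑ i, ω.toMultilinearMap.compLinearMap (update (fun _ => LinearMap.id) i x)
  have hg : ∀ w : ι → V, g w = ∑ i, ω (update w i (x (w i))) := by
    intro w
    rw [sum_apply]
    refine Finset.sum_congr rfl fun i _ => ?_
    rw [MultilinearMap.compLinearMap_apply]
    refine congrArg ω (funext fun j => ?_)
    by_cases h : j = i
    · subst h; simp
    · simp [h]
  let A : V [⋀^ι]→ₗ[K] K :=
    { g with
      map_eq_zero_of_eq' := fun w p q hpq hne => by
        change g w = 0
        rw [hg, Finset.sum_eq_add p q hne]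
        · have h1 : update w q (x (w q)) = update w p (x (w p)) ∘ Equiv.swap p q := by
            funext j
            by_cases hjp : j = p
            · subst hjp; simp [hne, hne.symm, hpq]
            · by_cases hjq : j = q
              · subst hjq; simp [hpq]
              · simp [Equiv.swap_apply_of_ne_of_ne hjp hjq, hjp, hjq]
          rw [h1, ω.map_swap _ hne, add_neg_cancel]
        · intro c _ hc
          exact ω.map_eq_zero_of_eq _ (by simp [hc.1.symm, hc.2.symm, hpq]) hne
        · simp
        · simp }
  have hA : A = LinearMap.trace K V x • ω := by
    have hb : A b = (LinearMap.trace K V x • ω) b := by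
      change g b = _
      rw [hg, LinearMap.trace_eq_matrix_trace K b, AlternatingMap.smul_apply, Matrix.trace,
        Finset.sum_smul]
      refine Finset.sum_congr rfl fun i _ => ?_
      rw [ω.update_basis, Matrix.diag_apply, LinearMap.toMatrix_apply]
    rw [A.eq_smul_basis_det b, hb, ← AlternatingMap.eq_smul_basis_det]
  rw [← hg]
  exact DFunLike.congr_fun hA v

/-- A semisimple Lie algebra acts by endomorphisms of trace zero. -/
theorem LieModule.trace_toEnd_eq_zero_of_isSemisimple {K L M : Type*} [Field K] [LieRing L]
    [LieAlgebra K L] [LieAlgebra.IsSemisimple K L] [AddCommGroup M] [Module K M]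
    [LieRingModule L M] [LieModule K L M] (x : L) :
    LinearMap.trace K M (toEnd K L M x) = 0 := by
  refine LieModule.trace_toEnd_eq_zero_of_mem_lcs K L M (k := 1) le_rfl ?_
  rw [lowerCentralSeries_succ, lowerCentralSeries_zero]
  exact LieIdeal.le_lie_self ⊤ (LieSubmodule.mem_top x)

variable {k s H}
variable {Pos : Set (Dual k H)}
variable (U : Type u) [AddCommGroup U] [Module k U] [LieRingModule s U] [LieModule k s U]
  [FiniteDimensional k U]

theorem exists_isGood_tensorPower (hPos : IsPositiveSystem k s H Pos) (n : ℕ) :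
    ∃ (T : LieModuleBundle k s) (t : (Fin n → U) → T.carrier)
      (E : MultilinearMap k (fun _ : Fin n => U) k →ₗ[k] T.carrier →ₗ[k] k),
      FiniteDimensional k T.carrier ∧ IsGood Pos U T.carrier ∧
      Submodule.span k (Set.range t) = ⊤ ∧ (∀ φ v, E φ (t v) = φ v) ∧
      ∀ (x : s) v, ⁅x, t v⁆ = ∑ i, t (update v i ⁅x, v i⁆) := by
  induction n with
  | zero =>
    refine ⟨⟨TrivialLieModule k s k⟩, fun _ => (TrivialLieModule.equiv k s k).symm 1,
      { toFun φ := φ 0 • (TrivialLieModule.equiv k s k).toLinearMap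
        map_add' a b := by rw [add_apply, add_smul]
        map_smul' c a := by rw [smul_apply, smul_assoc]; rfl },
      inferInstanceAs (FiniteDimensional k k), isGood_trivial U hPos, ?_, ?_, ?_⟩
    · rw [Set.range_const, eq_top_iff]
      intro c _
      exact Submodule.mem_span_singleton.2 ⟨TrivialLieModule.equiv k s k c, mul_one (M := k) c⟩
    · intro φ v
      rw [Subsingleton.elim v 0]
      exact mul_one (φ 0)
    · intro x v
      rw [Finset.univ_eq_empty, Finset.sum_empty]
      exact trivial_lie_zero s (TrivialLieModule k s k) x _
  | succ n ih =>
    obtain ⟨T, t, E, hfd, hgood, hspan, hE, hlie⟩ := ih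
    refine ⟨⟨U ⊗[k] T.carrier⟩, fun v => v 0 ⊗ₜ t (Fin.tail v),
      { toFun φ := TensorProduct.lift (E ∘ₗ φ.curryLeft)
        map_add' a b := TensorProduct.ext' fun u w =>
          LinearMap.congr_fun (E.map_add (a.curryLeft u) (b.curryLeft u)) w
        map_smul' c a := TensorProduct.ext' fun u w =>
          LinearMap.congr_fun (E.map_smul c (a.curryLeft u)) w },
      inferInstance, (isGood_self U).tensorProduct U hPos hgood, ?_, ?_, ?_⟩
    · rw [eq_top_iff, ← TensorProduct.span_tmul_eq_top, Submodule.span_le]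
      rintro _ ⟨u, w, rfl⟩
      have : w ∈ Submodule.span k (Set.range t) := by rw [hspan]; trivial
      induction this using Submodule.span_induction with
      | mem w hw =>
        obtain ⟨v, rfl⟩ := hw
        exact Submodule.subset_span ⟨Fin.cons u v, by simp⟩
      | zero => simp
      | add a b _ _ ha hb => rw [TensorProduct.tmul_add]; exact add_mem ha hb
      | smul c a _ ha => rw [TensorProduct.tmul_smul]; exact Submodule.smul_mem _ c ha
    · intro φ v
      simp [hE]
    · intro x v
      rw [TensorProduct.LieModule.lie_tmul_right, hlie, Fin.sum_univ_succ, TensorProduct.tmul_sum]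
      simp [Fin.tail_update_succ]
      rfl

end Determinant

section Symmetry
open LieModule Module Function

theorem Basis.exists_det_cons {K V : Type*} [Field K] [AddCommGroup V] [Module K V] {m : ℕ}
    (b : Basis (Fin (m + 1)) K V) (i : Fin (m + 1)) :
    ∃ (v : Fin m → V) (c : K), c ≠ 0 ∧ ∀ u, b.det (Fin.cons u v) = c * b.repr u i := by
  refine ⟨Fin.tail (b ∘ Equiv.swap 0 i), ((Equiv.Perm.sign (Equiv.swap 0 i) : ℤ) : K), ?_,
    fun u => ?_⟩
  · rcases Int.units_eq_one_or (Equiv.Perm.sign (Equiv.swap 0 i)) with h | h <;> simp [h]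
  · have h : (Fin.cons u (Fin.tail (b ∘ Equiv.swap 0 i)) : Fin (m + 1) → V) =
        update b i u ∘ Equiv.swap 0 i := by
      funext j
      refine Fin.cases (by simp) (fun j => ?_) j
      have : Equiv.swap 0 i j.succ ≠ i := fun h => Fin.succ_ne_zero j <|
        (Equiv.swap 0 i).injective (h.trans (Equiv.swap_apply_left 0 i).symm)
      simp [Fin.tail, this]
    rw [h, AlternatingMap.map_perm, AlternatingMap.update_basis, b.det_self, smul_eq_mul, mul_one,
      Units.smul_def, zsmul_eq_mul]

theorem TensorProduct.exists_rTensor_coord_ne_zero {K V W ι : Type*} [Field K] [AddCommGroup V]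
    [Module K V] [AddCommGroup W] [Module K W] (b : Basis ι K V) {τ : V ⊗[K] W} (hτ : τ ≠ 0) :
    ∃ i, TensorProduct.lid K W ((b.coord i).rTensor W τ) ≠ 0 := by
  classical
  by_contra! h
  refine hτ ((TensorProduct.equivFinsuppOfBasisLeft b).injective ?_)
  rw [map_zero]
  ext i
  have key : ∀ τ : V ⊗[K] W, TensorProduct.equivFinsuppOfBasisLeft b τ i =
      TensorProduct.lid K W ((b.coord i).rTensor W τ) := by
    intro τ
    induction τ with
    | zero => simp
    | tmul v w => simp
    | add a c ha hc => simp only [map_add, Finsupp.add_apply, ha, hc]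
  rw [key, h, Finsupp.zero_apply]

variable {k s H}
variable {Pos : Set (Dual k H)}
variable {U : Type u} [AddCommGroup U] [Module k U] [LieRingModule s U] [LieModule k s U]
  [FiniteDimensional k U]

theorem HasTensorStep.reflTransGen_swap (hPos : IsPositiveSystem k s H Pos) {κ κ' : Dual k H}
    (h : HasTensorStep Pos U κ κ') : Relation.ReflTransGen (HasTensorStep Pos U) κ' κ := by
  obtain ⟨X, Y, hX, hY, f, hf⟩ := h
  have := hX.1
  have := hX.2.1
  have := hY.1
  have := hY.2.1
  obtain ⟨u₀, x₀, hu₀⟩ := LieModuleHom.exists_tmul_ne_zero hf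
  have : Nontrivial U := ⟨u₀, 0, by rintro rfl; simp at hu₀⟩
  obtain ⟨m, hm⟩ := Nat.exists_eq_succ_of_ne_zero (finrank_pos (R := k) (M := U)).ne'
  let b := finBasisOfFinrankEq k U hm
  obtain ⟨T, t, E, hfd, hgood, hspan, hE, hlie⟩ := exists_isGood_tensorPower U hPos m
  let D : U →ₗ[k] T.carrier →ₗ[k] k := E ∘ₗ b.det.toMultilinearMap.curryLeft
  have hDt : ∀ u v, D u (t v) = b.det (Fin.cons u v) := fun u v => hE _ v
  have hD : ∀ (z : s) u w, D ⁅z, u⁆ w + D u ⁅z, w⁆ = 0 := by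
    intro z u w
    have hw : w ∈ Submodule.span k (Set.range t) := by rw [hspan]; trivial
    induction hw using Submodule.span_induction with
    | mem w hw =>
      obtain ⟨v, rfl⟩ := hw
      have h1 := AlternatingMap.sum_update_eq_trace_smul b b.det (toEnd k s U z) (Fin.cons u v)
      rw [trace_toEnd_eq_zero_of_isSemisimple, zero_smul, Fin.sum_univ_succ] at h1
      rw [hlie, map_sum, ← h1, hDt]
      simp [hDt, Fin.cons_update]
    | zero => simp
    | add a c _ _ ha hc =>
      rw [lie_add, map_add, map_add, add_add_add_comm, ha, hc, add_zero]
    | smul r a _ ha => rw [lie_smul, map_smul, map_smul, ← smul_add, ha, smul_zero]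
  obtain ⟨σ, hσ⟩ := (LieModuleHom.surjective_of_isIrreducible hf : Surjective f) |>
    LieModuleHom.exists_section
  let C : T.carrier →ₗ[k] U ⊗[k] X.carrier →ₗ[k] X.carrier :=
    { toFun w := (TensorProduct.lid k X.carrier).toLinearMap ∘ₗ (D.flip w).rTensor X.carrier
      map_add' a c := TensorProduct.ext' fun u x => by simp
      map_smul' r a := TensorProduct.ext' fun u x => by simp }
  have hC : ∀ w u x, C w (u ⊗ₜ x) = D u w • x := fun w u x => by simp [C]
  have hClie : ∀ (z : s) w τ, C ⁅z, w⁆ τ + C w ⁅z, τ⁆ = ⁅z, C w τ⁆ := by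
    intro z w τ
    induction τ with
    | zero => simp
    | tmul u x =>
      rw [TensorProduct.LieModule.lie_tmul_right, map_add, hC, hC, hC, hC, ← add_assoc,
        ← add_smul, add_comm (D u _), hD, zero_smul, zero_add, lie_smul]
    | add a c ha hc => rw [lie_add, map_add, map_add, map_add, lie_add, ← ha, ← hc]; abel
  let g : T.carrier ⊗[k] Y.carrier →ₗ⁅k,s⁆ X.carrier :=
    LieModuleHom.ofTmul (TensorProduct.lift (C.compl₂ (σ : Y.carrier →ₗ[k] U ⊗[k] X.carrier)))
      fun z w y => by
        have := hClie z w (σ y)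
        rw [← LieModuleHom.map_lie] at this
        exact this
  refine hgood Y X κ' κ hY hX ⟨g, fun hg => ?_⟩
  have : Nontrivial Y.carrier := nontrivial_of_isIrreducible k s Y.carrier
  obtain ⟨y, hy⟩ := exists_ne (0 : Y.carrier)
  have hτ : σ y ≠ 0 := fun h0 => hy (by rw [← hσ y, h0, map_zero])
  obtain ⟨i, hi⟩ := TensorProduct.exists_rTensor_coord_ne_zero b hτ
  obtain ⟨v, c, hc, hv⟩ := Basis.exists_det_cons b i
  have h1 : C (t v) (σ y) = 0 := LieModuleHom.congr_fun hg (t v ⊗ₜ y)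
  have h2 : ∀ τ, C (t v) τ =
      c • TensorProduct.lid k X.carrier ((b.coord i).rTensor X.carrier τ) := by
    intro τ
    induction τ with
    | zero => simp
    | tmul u x => rw [hC, hDt, hv]; simp [mul_smul]
    | add a c ha hc => rw [map_add, map_add, map_add, smul_add, ha, hc]
  rw [h2] at h1
  exact hi ((smul_eq_zero.1 h1).resolve_left hc)

theorem reflTransGen_hasTensorStep_symm (hPos : IsPositiveSystem k s H Pos) {κ κ' : Dual k H}
    (h : Relation.ReflTransGen (HasTensorStep Pos U) κ κ') :
    Relation.ReflTransGen (HasTensorStep Pos U) κ' κ := by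
  induction h with
  | refl => exact .refl
  | tail _ h ih => exact (h.reflTransGen_swap hPos).trans ih

end Symmetry

section GoodWeights
open LieModule Module

theorem TensorProduct.tmul_ne_zero {K V W : Type*} [Field K] [AddCommGroup V] [Module K V]
    [AddCommGroup W] [Module K W] {v : V} {w : W} (hv : v ≠ 0) (hw : w ≠ 0) :
    v ⊗ₜ[K] w ≠ 0 := by
  intro h
  obtain ⟨f, hf, -⟩ := Submodule.exists_le_ker_of_notMem (K := K) (p := ⊥) (v := v) (by simpa)
  have h1 := congrArg (fun t => TensorProduct.lid K W (f.rTensor W t)) h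
  simp [hf, hw] at h1

variable {k s H}
variable {Pos : Set (Dual k H)}

theorem tmul_mem_wtSpace {V W : Type u}
    [AddCommGroup V] [Module k V] [LieRingModule s V] [LieModule k s V]
    [AddCommGroup W] [Module k W] [LieRingModule s W] [LieModule k s W]
    {κ ψ : Dual k H} {v : V} {w : W}
    (hv : v ∈ wtSpace k s H V κ) (hw : w ∈ wtSpace k s H W ψ) :
    v ⊗ₜ w ∈ wtSpace k s H (V ⊗[k] W) (κ + ψ) := fun x => by
  rw [TensorProduct.LieModule.lie_tmul_right, hv x, hw x, LinearMap.add_apply, add_smul,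
    TensorProduct.smul_tmul', TensorProduct.tmul_smul]

theorem IsHighestWeightVector.tmul {V W : Type u}
    [AddCommGroup V] [Module k V] [LieRingModule s V] [LieModule k s V]
    [AddCommGroup W] [Module k W] [LieRingModule s W] [LieModule k s W]
    {κ ψ : Dual k H} {v : V} {w : W}
    (hv : IsHighestWeightVector Pos V κ v) (hw : IsHighestWeightVector Pos W ψ w) :
    IsHighestWeightVector Pos (V ⊗[k] W) (κ + ψ) (v ⊗ₜ w) :=
  ⟨TensorProduct.tmul_ne_zero hv.1 hw.1, tmul_mem_wtSpace hv.2.1 hw.2.1, fun γ hγ x hx => by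
    rw [TensorProduct.LieModule.lie_tmul_right, hv.2.2 γ hγ x hx, hw.2.2 γ hγ x hx,
      TensorProduct.zero_tmul, TensorProduct.tmul_zero, add_zero]⟩

theorem lie_eq_zero_of_not_isRoot_add {γ δ : Dual k H} (h0 : γ + δ ≠ 0)
    (h : ¬ IsRoot k s H (γ + δ)) {x y : s} (hx : x ∈ wtSpace k s H s γ)
    (hy : y ∈ wtSpace k s H s δ) : ⁅x, y⁆ = 0 := by
  by_contra hne
  exact h ⟨h0, isWeightOf_of_mem (lie_mem_wtSpace hx hy) hne⟩

theorem mem_of_mem_wtSpace_zero {x : s} (hx : x ∈ wtSpace k s H s 0) : x ∈ H := by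
  rw [mem_wtSpace_iff_mem_rootSpace] at hx
  rwa [← LieAlgebra.zeroRootSubalgebra_eq_of_is_cartan k s H]

variable (U : Type u) [AddCommGroup U] [Module k U] [LieRingModule s U] [LieModule k s U]

variable (Pos) in
/-- `κ` is the weight of a highest weight vector in some finite-dimensional good module. -/
def IsGoodWeight (κ : Dual k H) : Prop :=
  ∃ (V : LieModuleBundle k s) (v : V.carrier), FiniteDimensional k V.carrier ∧
    IsGood Pos U V.carrier ∧ IsHighestWeightVector Pos V.carrier κ v

theorem isGoodWeight_zero (hPos : IsPositiveSystem k s H Pos) :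
    IsGoodWeight Pos U (0 : Dual k H) :=
  ⟨⟨TrivialLieModule k s k⟩, (TrivialLieModule.equiv k s k).symm 1,
    inferInstanceAs (FiniteDimensional k k), isGood_trivial U hPos, one_ne_zero (α := k),
    fun x => by
      rw [LinearMap.zero_apply, zero_smul]
      exact trivial_lie_zero s (TrivialLieModule k s k) _ _,
    fun γ _ x _ => trivial_lie_zero s (TrivialLieModule k s k) _ _⟩

variable {U}

theorem IsGoodWeight.add (hPos : IsPositiveSystem k s H Pos) {κ ψ : Dual k H}
    (h : IsGoodWeight Pos U κ) (h' : IsGoodWeight Pos U ψ) : IsGoodWeight Pos U (κ + ψ) := by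
  obtain ⟨V, v, hfd, hg, hv⟩ := h
  obtain ⟨V', v', hfd', hg', hv'⟩ := h'
  exact ⟨⟨V.carrier ⊗[k] V'.carrier⟩, v ⊗ₜ v', inferInstance, hg.tensorProduct U hPos hg',
    hv.tmul hv'⟩

theorem IsGoodWeight.reflTransGen (hPos : IsPositiveSystem k s H Pos) {κ lam : Dual k H}
    (h : IsGoodWeight Pos U κ) {X : LieModuleBundle k s}
    (hX : IsIrreducibleOfHighestWeight Pos X.carrier lam) :
    Relation.ReflTransGen (HasTensorStep Pos U) lam (lam + κ) := by
  obtain ⟨V, v, hfd, hg, hv⟩ := h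
  have := hX.2.1
  obtain ⟨x, hx⟩ := hX.exists_isHighestWeightVector hPos
  have hvx := hv.tmul hx
  rw [add_comm] at hvx
  have hZ := hvx.isIrreducibleOfHighestWeight_lieSpan hPos
  have hmem : v ⊗ₜ[k] x ∈ LieSubmodule.lieSpan k s {v ⊗ₜ[k] x} := LieSubmodule.subset_lieSpan rfl
  set Z := LieSubmodule.lieSpan k s {v ⊗ₜ[k] x}
  obtain ⟨p, hp⟩ := exists_projection Z
  refine hg X ⟨Z⟩ _ _ hX hZ ⟨p, fun h0 => hvx.1 ?_⟩
  have := hp ⟨_, hmem⟩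
  rw [h0] at this
  exact (congrArg Subtype.val this).symm

theorem IsHighestWeightVector.isGoodWeight_sub (hPos : IsPositiveSystem k s H Pos)
    {V : LieModuleBundle k s} [FiniteDimensional k V.carrier] (hg : IsGood Pos U V.carrier)
    {κ α : Dual k H} {v : V.carrier} (hv : IsHighestWeightVector Pos V.carrier κ v)
    (hα : IsSimpleRoot Pos α) {f : s} (hf : f ∈ wtSpace k s H s (-α)) (hfv : ⁅f, v⁆ ≠ 0) :
    IsGoodWeight Pos U (κ + κ - α) := by
  refine ⟨⟨V.carrier ⊗[k] V.carrier⟩, v ⊗ₜ ⁅f, v⁆ - ⁅f, v⁆ ⊗ₜ v, inferInstance,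
    hg.tensorProduct U hPos hg, hPos.isHighestWeightVector_of_simple ?_ ?_ ?_⟩
  · intro h0
    have hnot : v ∉ Submodule.span k {⁅f, v⁆} := by
      intro h
      obtain ⟨c, hc⟩ := Submodule.mem_span_singleton.1 h
      refine (hPos.1 α hα.1).1 (LinearMap.ext fun x => ?_)
      have h1 := Submodule.smul_mem _ c (lie_mem_wtSpace hf hv.2.1) x
      rw [hc, hv.2.1 x, ← sub_eq_zero, ← sub_smul] at h1
      simpa using (smul_eq_zero.1 h1).resolve_right hv.1
    obtain ⟨φ, hφ, hle⟩ := Submodule.exists_le_ker_of_notMem hnot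
    have h1 := congrArg (fun t => TensorProduct.lid k V.carrier (φ.rTensor V.carrier t)) h0
    have h2 : φ ⁅f, v⁆ = 0 := hle (Submodule.mem_span_singleton_self _)
    simp [h2, hφ, hfv] at h1
  · refine sub_mem ?_ ?_
    · have := tmul_mem_wtSpace hv.2.1 (lie_mem_wtSpace hf hv.2.1)
      rwa [show κ + (-α + κ) = κ + κ - α by abel] at this
    · have := tmul_mem_wtSpace (lie_mem_wtSpace hf hv.2.1) hv.2.1
      rwa [show -α + κ + κ = κ + κ - α by abel] at this
  · intro β hβ e he
    have h1 : ∃ c : k, ⁅e, ⁅f, v⁆⁆ = c • v := by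
      rw [leibniz_lie, hv.2.2 β hβ.1 e he, lie_zero, add_zero]
      by_cases hαβ : β = α
      · subst hαβ
        have := lie_mem_wtSpace he hf
        rw [add_neg_cancel] at this
        exact ⟨κ ⟨_, mem_of_mem_wtSpace_zero this⟩, hv.2.1 ⟨_, mem_of_mem_wtSpace_zero this⟩⟩
      · rw [lie_eq_zero_of_not_isRoot_add (γ := β) (δ := -α) _ _ he hf]
        · exact ⟨0, by simp⟩
        · rwa [← sub_eq_add_neg, sub_ne_zero]
        · rw [← sub_eq_add_neg]
          exact hPos.not_isRoot_sub hβ hα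
    obtain ⟨c, hc⟩ := h1
    rw [lie_sub, TensorProduct.LieModule.lie_tmul_right, TensorProduct.LieModule.lie_tmul_right,
      hc, hv.2.2 β hβ.1 e he, TensorProduct.zero_tmul, TensorProduct.tmul_zero, zero_add, add_zero,
      TensorProduct.tmul_smul, TensorProduct.smul_tmul', sub_self]

end GoodWeights

section GoodLattice
open LieModule Module

variable {k s H}
variable {Pos : Set (Dual k H)}
variable (U : Type u) [AddCommGroup U] [Module k U] [LieRingModule s U] [LieModule k s U]

variable (Pos) in
/-- The root spaces of `-β` annihilate all highest weight vectors of good modules. -/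
def IsInert (β : Dual k H) : Prop :=
  ∀ (V : LieModuleBundle k s) (v : V.carrier) (κ : Dual k H), FiniteDimensional k V.carrier →
    IsGood Pos U V.carrier → IsHighestWeightVector Pos V.carrier κ v →
    ∀ x ∈ wtSpace k s H s (-β), ⁅x, v⁆ = 0

variable (Pos) in
/-- The group generated by the good weights. -/
def goodLattice : AddSubgroup (Dual k H) := AddSubgroup.closure {κ | IsGoodWeight Pos U κ}

variable {U}

theorem mem_goodLattice_of_not_isInert (hPos : IsPositiveSystem k s H Pos) {α : Dual k H}
    (hα : IsSimpleRoot Pos α) (h : ¬ IsInert Pos U α) : α ∈ goodLattice Pos U := by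
  simp only [IsInert, not_forall] at h
  obtain ⟨V, v, κ, hfd, hg, hv, x, hx, hne⟩ := h
  have h1 : κ ∈ goodLattice Pos U := AddSubgroup.subset_closure ⟨V, v, hfd, hg, hv⟩
  have h2 : κ + κ - α ∈ goodLattice Pos U :=
    AddSubgroup.subset_closure (hv.isGoodWeight_sub hPos hg hα hx hne)
  simpa using sub_mem (add_mem h1 h1) h2

theorem IsInert.not_isRoot_add (hPos : IsPositiveSystem k s H Pos) {α β : Dual k H}
    (hβ : IsInert Pos U β) (hβs : IsSimpleRoot Pos β) (hα : IsSimpleRoot Pos α)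
    (hαG : α ∈ goodLattice Pos U) : ¬ IsRoot k s H (α + β) := by
  obtain ⟨h, e, f, ht, he, hf, -, hroots⟩ := (hPos.1 β hβs.1).exists_isSl2Triple
  have h0 : ∀ γ ∈ goodLattice Pos U, γ h = 0 := by
    intro γ hγ
    induction hγ using AddSubgroup.closure_induction with
    | mem κ hκ =>
      obtain ⟨V, v, hfd, hg, hv⟩ := hκ
      have h1 := hv.2.1 h
      rw [← ht.lie_e_f, lie_lie, hβ V v κ hfd hg hv f hf, hv.2.2 β hβs.1 e he, lie_zero,
        lie_zero, sub_zero] at h1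
      exact (smul_eq_zero.1 h1.symm).resolve_right hv.1
    | zero => rfl
    | add a b _ _ ha hb => rw [LinearMap.add_apply, ha, hb, add_zero]
    | neg a _ ha => rw [LinearMap.neg_apply, ha, neg_zero]
  obtain ⟨m, hm, -, hm0⟩ := hroots α (hPos.1 α hα.1)
  rw [h0 α hαG, eq_comm, Int.cast_eq_zero] at hm
  exact hm0 hm (hPos.not_isRoot_sub hα hβs)

theorem not_isInert [FiniteDimensional k U] (hPos : IsPositiveSystem k s H Pos)
    (hU : ∀ x : s, (∀ m : U, ⁅x, m⁆ = 0) → x = 0) {β : Dual k H} (hβs : IsSimpleRoot Pos β) :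
    ¬ IsInert Pos U β := by
  intro hβ
  let Y : Submodule k U :=
    { carrier := {m | ∀ β, IsSimpleRoot Pos β → IsInert Pos U β → ∀ x,
        (x ∈ wtSpace k s H s β ∨ x ∈ wtSpace k s H s (-β)) → ⁅x, m⁆ = 0}
      add_mem' := fun ha hb β h1 h2 x hx => by
        rw [lie_add, ha β h1 h2 x hx, hb β h1 h2 x hx, add_zero]
      zero_mem' := fun β _ _ x _ => lie_zero x
      smul_mem' := fun c m hm β h1 h2 x hx => by rw [lie_smul, hm β h1 h2 x hx, smul_zero] }
  let S : LieSubalgebra k s :=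
    { carrier := {z | ∀ m ∈ Y, ⁅z, m⁆ ∈ Y}
      add_mem' := fun ha hb m hm => by rw [add_lie]; exact add_mem (ha m hm) (hb m hm)
      zero_mem' := fun m _ => by rw [zero_lie]; exact zero_mem Y
      smul_mem' := fun c z hz m hm => by rw [smul_lie]; exact Y.smul_mem c (hz m hm)
      lie_mem' := fun {x y} hx hy m hm => by
        rw [lie_lie]
        exact sub_mem (hx _ (hy m hm)) (hy _ (hx m hm)) }
  have hS : ∀ α, IsSimpleRoot Pos α →
      ∀ z, (z ∈ wtSpace k s H s α ∨ z ∈ wtSpace k s H s (-α)) → z ∈ S := by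
    intro α hα z hz m hm
    by_cases hαi : IsInert Pos U α
    · rw [hm α hα hαi z hz]
      exact zero_mem Y
    · intro γ hγ hγi x hx
      have hαG := mem_goodLattice_of_not_isInert hPos hα hαi
      have h1 := hγi.not_isRoot_add hPos hγ hα hαG
      have h2 := hPos.not_isRoot_sub hα hγ
      have h3 : α + γ ≠ 0 := fun h => (hPos.1 α hα.1).1 <|
        hPos.eq_zero_of_neg_mem (AddSubmonoid.subset_closure hα.1)
          (by rw [neg_eq_of_add_eq_zero_right h]; exact AddSubmonoid.subset_closure hγ.1)
      have h4 : α - γ ≠ 0 := fun h => hαi (by rwa [sub_eq_zero.1 h])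
      have hzx : ⁅x, z⁆ = 0 := by
        rcases hx with hx | hx <;> rcases hz with hz | hz
        · refine lie_eq_zero_of_not_isRoot_add ?_ ?_ hx hz <;> rwa [add_comm]
        · have h5 : γ + -α = -(α - γ) := by abel
          refine lie_eq_zero_of_not_isRoot_add ?_ ?_ hx hz <;> rw [h5]
          · rwa [neg_ne_zero]
          · exact fun h => h2 (by simpa using h.neg)
        · have h5 : -γ + α = α - γ := by abel
          refine lie_eq_zero_of_not_isRoot_add ?_ ?_ hx hz <;> rwa [h5]
        · have h5 : -γ + -α = -(α + γ) := by abel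
          refine lie_eq_zero_of_not_isRoot_add ?_ ?_ hx hz <;> rw [h5]
          · rwa [neg_ne_zero]
          · exact fun h => h1 (by simpa using h.neg)
      rw [leibniz_lie, hzx, zero_lie, zero_add, hm γ hγ hγi x hx, lie_zero]
  have hST : S = ⊤ := hPos.lieSubalgebra_eq_top (fun α hα x hx => hS α hα x (.inl hx))
    fun α hα x hx => hS α hα x (.inr hx)
  let N : LieSubmodule k s U :=
    { Y with lie_mem := fun {x m} hm => (by rw [hST]; trivial : x ∈ S) m hm }
  obtain ⟨N', hc⟩ := exists_isCompl_lieSubmodule N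
  have hN' : N' = ⊥ := by
    by_contra hne
    have : Nontrivial N' := (LieSubmodule.nontrivial_iff_ne_bot k s U).2 hne
    obtain ⟨κ, v, hv⟩ := hPos.exists_isHighestWeightVector (M := N')
    have hvU := isHighestWeightVector_coe.2 hv
    have hvN : (v : U) ∈ N ⊓ N' := by
      refine ⟨fun γ hγ hγi x hx => ?_, v.2⟩
      rcases hx with hx | hx
      · exact hvU.2.2 γ hγ.1 x hx
      · exact hγi ⟨U⟩ v κ inferInstance (isGood_self U) hvU x hx
    rw [hc.inf_eq_bot, LieSubmodule.mem_bot] at hvN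
    exact hvU.1 hvN
  have hN : N = ⊤ := by simpa [hN'] using hc.sup_eq_top
  obtain ⟨e, he, he0⟩ := (hPos.1 β hβs.1).exists_ne_zero
  refine he0 (hU e fun m => ?_)
  have hm : m ∈ N := by rw [hN]; trivial
  exact hm β hβs hβ e (.inl he)

theorem isWeightOf_mem_goodLattice [FiniteDimensional k U] (hPos : IsPositiveSystem k s H Pos)
    (hU : ∀ x : s, (∀ m : U, ⁅x, m⁆ = 0) → x = 0) {χ : Dual k H} (hχ : IsWeightOf k s H U χ) :
    χ ∈ goodLattice Pos U := by
  have hP : AddSubmonoid.closure Pos ≤ (goodLattice Pos U).toAddSubmonoid :=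
    (AddSubmonoid.closure_le).2 fun α hα => hPos.induction (P := (· ∈ goodLattice Pos U))
      (fun α hα => mem_goodLattice_of_not_isInert hPos hα (not_isInert hPos hU hα))
      (fun β _ γ _ _ => add_mem) hα
  obtain ⟨κ, v, hv, h⟩ := hPos.exists_isHighestWeightVector_of_isWeightOf hχ
  have h1 : κ ∈ goodLattice Pos U :=
    AddSubgroup.subset_closure ⟨⟨U⟩, v, inferInstance, isGood_self U, hv⟩
  simpa using sub_mem h1 (hP h)

theorem exists_sub_of_mem_goodLattice (hPos : IsPositiveSystem k s H Pos) {χ : Dual k H}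
    (hχ : χ ∈ goodLattice Pos U) :
    ∃ a b, IsGoodWeight Pos U a ∧ IsGoodWeight Pos U b ∧ χ = a - b := by
  induction hχ using AddSubgroup.closure_induction with
  | mem a ha => exact ⟨a, 0, ha, isGoodWeight_zero U hPos, (sub_zero a).symm⟩
  | zero => exact ⟨0, 0, isGoodWeight_zero U hPos, isGoodWeight_zero U hPos, (sub_zero 0).symm⟩
  | add _ _ _ _ h1 h2 =>
    obtain ⟨a, b, ha, hb, rfl⟩ := h1
    obtain ⟨c, d, hc, hd, rfl⟩ := h2
    exact ⟨a + c, b + d, ha.add hPos hc, hb.add hPos hd, by abel⟩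
  | neg _ _ h =>
    obtain ⟨a, b, ha, hb, rfl⟩ := h
    exact ⟨b, a, hb, ha, neg_sub a b⟩

theorem reflTransGen_of_sub_mem_closure [FiniteDimensional k U] (hPos : IsPositiveSystem k s H Pos)
    (hU : ∀ x : s, (∀ m : U, ⁅x, m⁆ = 0) → x = 0) {X Y : LieModuleBundle k s}
    {lam mu : Dual k H} (hX : IsIrreducibleOfHighestWeight Pos X.carrier lam)
    (hY : IsIrreducibleOfHighestWeight Pos Y.carrier mu)
    (h : mu - lam ∈ AddSubgroup.closure {χ | IsWeightOf k s H U χ}) :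
    Relation.ReflTransGen (HasTensorStep Pos U) lam mu := by
  have h1 : mu - lam ∈ goodLattice Pos U :=
    (AddSubgroup.closure_le _).2 (fun χ hχ => isWeightOf_mem_goodLattice hPos hU hχ) h
  obtain ⟨a, b, ha, hb, hab⟩ := exists_sub_of_mem_goodLattice hPos h1
  have h2 : lam + a = mu + b := by rw [sub_eq_sub_iff_add_eq_add] at hab; rw [hab, add_comm]
  refine (ha.reflTransGen hPos hX).trans ?_
  rw [h2]
  exact reflTransGen_hasTensorStep_symm hPos (hb.reflTransGen hPos hY)

end GoodLattice

section WeightLattice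
open LieModule Module

variable {k s H}
variable {Pos : Set (Dual k H)}

theorem isIntegralWeight_zero : IsIntegralWeight k s H 0 := by
  refine ⟨⟨TrivialLieModule k s k⟩, inferInstanceAs (FiniteDimensional k k),
    isWeightOf_of_mem (m := (TrivialLieModule.equiv k s k).symm 1) (fun x => ?_)
      (one_ne_zero (α := k))⟩
  rw [LinearMap.zero_apply, zero_smul]
  exact trivial_lie_zero s (TrivialLieModule k s k) _ _

theorem IsIntegralWeight.add {χ ψ : Dual k H} (hχ : IsIntegralWeight k s H χ)
    (hψ : IsIntegralWeight k s H ψ) : IsIntegralWeight k s H (χ + ψ) := by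
  obtain ⟨V, hV, h⟩ := hχ
  obtain ⟨W, hW, h'⟩ := hψ
  obtain ⟨v, hv, hv0⟩ := h.exists_ne_zero
  obtain ⟨w, hw, hw0⟩ := h'.exists_ne_zero
  exact ⟨⟨V.carrier ⊗[k] W.carrier⟩, inferInstance,
    isWeightOf_of_mem (tmul_mem_wtSpace hv hw) (TensorProduct.tmul_ne_zero hv0 hw0)⟩

theorem IsIntegralWeight.neg {χ : Dual k H} (hχ : IsIntegralWeight k s H χ) :
    IsIntegralWeight k s H (-χ) := by
  obtain ⟨V, hV, h⟩ := hχ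
  obtain ⟨v, hv, hv0⟩ := h.exists_ne_zero
  have hnot : v ∉ ⨆ ψ, ⨆ _ : ψ ≠ χ, wtSpace k s H V.carrier ψ := fun hmem =>
    hv0 (Submodule.disjoint_def.1 (iSupIndep_wtSpace χ) v hv hmem)
  obtain ⟨φ, hφ, hle⟩ := Submodule.exists_le_ker_of_notMem hnot
  refine ⟨⟨Dual k V.carrier⟩, inferInstance, isWeightOf_of_mem (m := φ) (fun x => ?_) ?_⟩
  · refine LinearMap.ext fun n => ?_
    rw [Dual.lie_apply, LinearMap.neg_apply, LinearMap.smul_apply, neg_smul, neg_inj]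
    refine wtSpace_induction H (P := fun n => φ ⁅(x : s), n⁆ = χ x • φ n) ?_
      (fun a b ha hb => ?_) (fun ψ n hn => ?_) n
    · rw [lie_zero, map_zero, smul_zero]
    · rw [lie_add, map_add, map_add, ha, hb, smul_add]
    · rw [hn x, map_smul]
      by_cases hψ : ψ = χ
      · rw [hψ]
      · have : φ n = 0 := hle (Submodule.mem_iSup_of_mem ψ (Submodule.mem_iSup_of_mem hψ hn))
        rw [this, smul_zero, smul_zero]
  · rintro rfl
    exact hφ rfl

variable {U : Type u} [AddCommGroup U] [Module k U] [LieRingModule s U] [LieModule k s U]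
  [FiniteDimensional k U]

theorem isIntegralWeight_of_mem_closure {χ : Dual k H}
    (hχ : χ ∈ AddSubgroup.closure {χ | IsWeightOf k s H U χ}) : IsIntegralWeight k s H χ := by
  induction hχ using AddSubgroup.closure_induction with
  | mem χ hχ => exact ⟨⟨U⟩, inferInstance, hχ⟩
  | zero => exact isIntegralWeight_zero
  | add _ _ _ _ h1 h2 => exact h1.add h2
  | neg _ _ h => exact h.neg

theorem rootLattice_le_closure (hU : ∀ x : s, (∀ m : U, ⁅x, m⁆ = 0) → x = 0) :
    rootLattice k s H ≤ AddSubgroup.closure {χ | IsWeightOf k s H U χ} := by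
  refine (AddSubgroup.closure_le _).2 fun α hα => ?_
  obtain ⟨e, he, he0⟩ := IsRoot.exists_ne_zero hα
  have : ∃ χ : Dual k H, ∃ m ∈ wtSpace k s H U χ, ⁅e, m⁆ ≠ 0 := by
    by_contra! h
    exact he0 (hU e (wtSpace_induction H (lie_zero e)
      (fun a b ha hb => by rw [lie_add, ha, hb, add_zero]) h))
  obtain ⟨χ, m, hm, hne⟩ := this
  have h1 : IsWeightOf k s H U χ := isWeightOf_of_mem hm fun h => hne (by rw [h, lie_zero])
  have h2 : IsWeightOf k s H U (α + χ) := isWeightOf_of_mem (lie_mem_wtSpace he hm) hne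
  simpa using sub_mem (AddSubgroup.subset_closure h2)
    (AddSubgroup.subset_closure (k := {χ | IsWeightOf k s H U χ}) h1)

theorem sub_mem_closure_of_hom (hPos : IsPositiveSystem k s H Pos)
    (hU : ∀ x : s, (∀ m : U, ⁅x, m⁆ = 0) → x = 0) {X Y : Type u}
    [AddCommGroup X] [Module k X] [LieRingModule s X] [LieModule k s X] [FiniteDimensional k X]
    [AddCommGroup Y] [Module k Y] [LieRingModule s Y] [LieModule k s Y] {κ κ' : Dual k H}
    (hX : IsHighestWeightOf k s H Pos X κ) (hY : IsHighestWeightOf k s H Pos Y κ')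
    {f : U ⊗[k] X →ₗ⁅k,s⁆ Y} (hf : f ≠ 0) :
    κ' - κ ∈ AddSubgroup.closure {χ | IsWeightOf k s H U χ} := by
  have : ∃ χ : Dual k H, ∃ u ∈ wtSpace k s H U χ, ∃ ψ : Dual k H, ∃ x ∈ wtSpace k s H X ψ,
      f (u ⊗ₜ x) ≠ 0 := by
    by_contra! h
    obtain ⟨u, x, hux⟩ := LieModuleHom.exists_tmul_ne_zero hf
    refine hux (wtSpace_induction H (P := fun u => ∀ x, f (u ⊗ₜ[k] x) = 0) (by simp)
      (fun a b ha hb x => by rw [TensorProduct.add_tmul, map_add, ha, hb, add_zero])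
      (fun χ u hu => wtSpace_induction H (by simp)
        (fun a b ha hb => by rw [TensorProduct.tmul_add, map_add, ha, hb, add_zero])
        (h χ u hu)) u x)
  obtain ⟨χ, u, hu, ψ, x, hx, hne⟩ := this
  have hQ : AddSubmonoid.closure Pos ≤
      (AddSubgroup.closure {χ | IsWeightOf k s H U χ}).toAddSubmonoid :=
    (AddSubmonoid.closure_le).2 fun α hα =>
      rootLattice_le_closure hU (AddSubgroup.subset_closure (hPos.1 α hα))
  have hu0 : u ≠ 0 := by rintro rfl; simp at hne
  have hx0 : x ≠ 0 := by rintro rfl; simp at hne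
  have h1 : κ - ψ ∈ AddSubgroup.closure {χ | IsWeightOf k s H U χ} :=
    hQ (hX.2 ψ (isWeightOf_of_mem hx hx0))
  have h2 : κ' - (χ + ψ) ∈ AddSubgroup.closure {χ | IsWeightOf k s H U χ} :=
    hQ (hY.2 _ (isWeightOf_of_mem (map_mem_wtSpace f (tmul_mem_wtSpace hu hx)) hne))
  have h3 : χ ∈ AddSubgroup.closure {χ | IsWeightOf k s H U χ} :=
    AddSubgroup.subset_closure (isWeightOf_of_mem hu hu0)
  have := add_mem (sub_mem h2 h1) h3
  rwa [show κ' - (χ + ψ) - (κ - ψ) + χ = κ' - κ by abel] at this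

theorem exists_chain_of_reflTransGen (hPos : IsPositiveSystem k s H Pos) {X : LieModuleBundle k s}
    {lam mu : Dual k H} (hX : IsIrreducibleOfHighestWeight Pos X.carrier lam)
    (h : Relation.ReflTransGen (HasTensorStep Pos U) lam mu) :
    ∃ (n : ℕ) (Xs : Fin (n + 1) → LieModuleBundle k s) (lams : Fin (n + 1) → Dual k H),
      lams 0 = lam ∧ lams (Fin.last n) = mu ∧
      (∀ i, IsIrreducibleOfHighestWeight Pos (Xs i).carrier (lams i)) ∧
      ∀ i : Fin n, ∃ f : (U ⊗[k] (Xs i.castSucc).carrier) →ₗ⁅k,s⁆ (Xs i.succ).carrier, f ≠ 0 := by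
  induction h with
  | refl => exact ⟨0, fun _ => X, fun _ => lam, rfl, rfl, fun _ => hX, fun i => i.elim0⟩
  | @tail κ κ' _ hstep ih =>
    obtain ⟨n, Xs, lams, h0, hn, hXs, hf⟩ := ih
    obtain ⟨-, Y, -, hY, -⟩ := id hstep
    refine ⟨n + 1, Fin.snoc (α := fun _ => LieModuleBundle k s) Xs Y,
      Fin.snoc (α := fun _ => Dual k H) lams κ', ?_, ?_, ?_, ?_⟩
    · rw [← Fin.castSucc_zero, Fin.snoc_castSucc, h0]
    · rw [Fin.snoc_last]
    · refine Fin.lastCases ?_ fun i => ?_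
      · rwa [Fin.snoc_last, Fin.snoc_last]
      · rw [Fin.snoc_castSucc, Fin.snoc_castSucc]
        exact hXs i
    · refine Fin.lastCases ?_ fun i => ?_
      · rw [Fin.snoc_castSucc, Fin.succ_last, Fin.snoc_last]
        exact hstep.exists_hom hPos (hn ▸ hXs (Fin.last n)) hY
      · rw [Fin.snoc_castSucc, Fin.succ_castSucc, Fin.snoc_castSucc]
        exact hf i

end WeightLattice

/-- Let `U` be a finite-dimensional faithful `s`-module.  Then
`Q ⊆ Span_ℤ wt(U) ⊆ P`, and for dominant integral `lam`, `mu` the following are equivalent: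
(1) there is a chain of irreducible finite-dimensional modules with highest weights
`lam = lam₀, lam₁, …, lamₙ = mu` and `Hom_s(U ⊗ X_i, X_{i+1}) ≠ 0` at each step;
(2) `mu − lam ∈ Span_ℤ wt(U)`. -/
theorem rootLattice_le_span_weights_and_chain_iff
    (Pos : Set (Module.Dual k ↥H)) (hPos : IsPositiveSystem k s H Pos)
    (U : Type u) [AddCommGroup U] [Module k U] [LieRingModule s U] [LieModule k s U]
    [FiniteDimensional k U]
    (hUfaithful : ∀ x : s, (∀ m : U, ⁅x, m⁆ = 0) → x = 0) :
    (rootLattice k s H ≤ AddSubgroup.closure {χ | IsWeightOf k s H U χ}) ∧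
    (∀ χ ∈ AddSubgroup.closure {χ | IsWeightOf k s H U χ}, IsIntegralWeight k s H χ) ∧
    (∀ lam mu : Module.Dual k ↥H,
      IsDominant k s H Pos lam → IsDominant k s H Pos mu →
      ((∃ (n : ℕ) (Xs : Fin (n + 1) → LieModuleBundle k s)
          (lams : Fin (n + 1) → Module.Dual k ↥H),
          lams 0 = lam ∧ lams (Fin.last n) = mu ∧
          (∀ i, LieModule.IsIrreducible k s (Xs i).carrier ∧
            FiniteDimensional k (Xs i).carrier ∧
            IsHighestWeightOf k s H Pos (Xs i).carrier (lams i)) ∧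
          (∀ i : Fin n,
            ∃ f : (U ⊗[k] (Xs i.castSucc).carrier) →ₗ⁅k,s⁆ (Xs i.succ).carrier, f ≠ 0)) ↔
        mu - lam ∈ AddSubgroup.closure {χ | IsWeightOf k s H U χ})) := by
  refine ⟨rootLattice_le_closure hUfaithful, fun χ => isIntegralWeight_of_mem_closure,
    fun lam mu ⟨X, hX⟩ ⟨Y, hY⟩ => ⟨?_, fun h => ?_⟩⟩
  · rintro ⟨n, Xs, lams, rfl, rfl, hXs, hf⟩
    have key : ∀ i, lams i - lams 0 ∈ AddSubgroup.closure {χ | IsWeightOf k s H U χ} := by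
      refine Fin.induction (by rw [sub_self]; exact zero_mem _) fun i ih => ?_
      obtain ⟨f, hf⟩ := hf i
      have := (hXs i.castSucc).2.1
      simpa using add_mem
        (sub_mem_closure_of_hom hPos hUfaithful (hXs i.castSucc).2.2 (hXs i.succ).2.2 hf) ih
    exact key (Fin.last n)
  · exact exists_chain_of_reflTransGen hPos hX
      (reflTransGen_of_sub_mem_closure hPos hUfaithful hX hY h)
end
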